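/- arXiv:0812.1289 — 2 statements merged into one kernel-verified Lean document; each statement's English description precedes it below -/
import Mathlib

section
/- Let R be a commutative noetherian ring, let a and b be ideals of R, let X be an R-module, and let t be a non-negative integer such that H^{t-r}_a(H^r_b(X)) = 0 for all r with 0 ≤ r ≤ t. Then H^t_{a+b}(X) = 0. -/
open CategoryTheory

namespace LCAux
open Abelian

variable {R : Type} [CommRing R]

abbrev yo {M : ModuleCat.{0} R} (P : ProjectiveResolution M) (X : ModuleCat.{0} R) :
    CochainComplex (ModuleCat.{0} R) ℕ := P.complex.linearYonedaObj R X

/-- Generic facts on cycles of complexes of modules. -/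
lemma exists_cycle (K : CochainComplex (ModuleCat.{0} R) ℕ) (i : ℕ) (f : K.X i)
    (hf : (K.d i (i+1)).hom f = 0) : ∃ z : K.cycles i, (K.iCycles i).hom z = f := by
  let φ : ModuleCat.of R R ⟶ K.X i := ModuleCat.ofHom (LinearMap.toSpanSingleton R _ f)
  have hφ : φ ≫ K.d i (i+1) = 0 := by
    ext
    simp [φ, hf]
  refine ⟨(K.liftCycles φ (i+1) (by simp) hφ).hom 1, ?_⟩
  have h2 := K.liftCycles_i φ (i+1) (by simp) hφ
  have := congr($(h2).hom 1)
  refine this.trans ?_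
  simp [φ]

lemma iCycles_inj (K : CochainComplex (ModuleCat.{0} R) ℕ) (i : ℕ) :
    Function.Injective (K.iCycles i).hom :=
  (ModuleCat.mono_iff_injective _).1 inferInstance

lemma homologyπ_surj (K : CochainComplex (ModuleCat.{0} R) ℕ) (i : ℕ) :
    Function.Surjective (K.homologyπ i).hom :=
  (ModuleCat.epi_iff_surjective _).1 inferInstance

lemma homologyπ_eq_zero (K : CochainComplex (ModuleCat.{0} R) ℕ) (i : ℕ) (z : K.cycles i) :
    (K.homologyπ i).hom z = 0 ↔
      ∃ g : K.X ((ComplexShape.up ℕ).prev i), (K.d _ i).hom g = (K.iCycles i).hom z := by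
  have hex := ShortComplex.exact_of_g_is_cokernel
    (ShortComplex.mk _ _ (K.toCycles_comp_homologyπ ((ComplexShape.up ℕ).prev i) i))
    (K.homologyIsCokernel _ i rfl)
  rw [ShortComplex.moduleCat_exact_iff] at hex
  constructor
  · intro h
    obtain ⟨g, hg⟩ := hex z h
    refine ⟨g, ?_⟩
    rw [← hg]
    exact congr($(K.toCycles_i _ i).hom g).symm
  · rintro ⟨g, hg⟩
    have : z = (K.toCycles _ i).hom g := by
      apply iCycles_inj
      rw [← hg]
      exact congr($(K.toCycles_i _ i).hom g).symm
    rw [this]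
    exact congr($(K.toCycles_comp_homologyπ ((ComplexShape.up ℕ).prev i) i).hom g)

/-- cycles as morphisms -/
noncomputable def cyc {M : ModuleCat.{0} R} (P : ProjectiveResolution M) (X : ModuleCat.{0} R)
    (i : ℕ) : (yo P X).cycles i →ₗ[R] (P.complex.X i ⟶ X) := ((yo P X).iCycles i).hom

lemma yo_cocycle {M : ModuleCat.{0} R} (P : ProjectiveResolution M) (X : ModuleCat.{0} R) (i : ℕ)
    (z : (yo P X).cycles i) :
    P.complex.d (i+1) i ≫ cyc P X i z = 0 := by
  have h := (yo P X).iCycles_d i (i+1)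
  have := congr($(h).hom z)
  exact this

lemma extMk_eq_zero {M : ModuleCat.{0} R} (P : ProjectiveResolution M) (X : ModuleCat.{0} R) (i : ℕ)
    (f : P.complex.X i ⟶ X) (hf : P.complex.d (i+1) i ≫ f = 0) :
    P.extMk f (i+1) rfl hf = 0 ↔
      ∃ g : P.complex.X ((ComplexShape.up ℕ).prev i) ⟶ X, P.complex.d i _ ≫ g = f := by
  cases i with
  | succ p =>
    rw [P.extMk_eq_zero_iff f _ rfl hf p rfl]
    have : (ComplexShape.up ℕ).prev (p+1) = p := by simp
    rw [this]
  | zero =>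
    have : (ComplexShape.up ℕ).prev 0 = 0 := by simp
    rw [this]
    simp only [← P.extEquivCohomologyClass.apply_eq_iff_eq,
      ProjectiveResolution.extEquivCohomologyClass_extMk,
      ProjectiveResolution.extEquivCohomologyClass_zero,
      CochainComplex.HomComplex.CohomologyClass.mk_eq_zero_iff]
    rw [CochainComplex.HomComplex.Cocycle.toSingleMk_mem_coboundaries_iff _ _ _ _ _ 1 (by simp)]
    have hd : P.cochainComplex.d (-((0:ℕ):ℤ)) 1 = 0 := by
      apply Limits.IsZero.eq_of_tgt
      exact CochainComplex.isZero_of_isStrictlyLE _ 0 1 (by simp)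
    simp only [hd, Limits.zero_comp, exists_const]
    have hd2 : P.complex.d 0 0 = 0 := P.complex.shape _ _ (by simp)
    simp only [hd2, Limits.zero_comp, exists_const]
    constructor
    · intro h
      have h2 := congr((P.cochainComplexXIso (-((0:ℕ):ℤ)) 0 rfl).inv ≫ $h)
      simpa using h2
    · intro h
      rw [← h]; simp

noncomputable def newMap {M : ModuleCat.{0} R} (P : ProjectiveResolution M) (X : ModuleCat.{0} R) (i : ℕ) :
    (yo P X).cycles i →ₗ[R] Ext M X i where
  toFun z := P.extMk (cyc P X i z) (i+1) rfl (yo_cocycle P X i z)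
  map_add' x y := by
    rw [ProjectiveResolution.add_extMk]
    congr 1
    exact map_add (cyc P X i) x y
  map_smul' r x := by
    rw [Ext.smul_eq_comp_mk₀]
    simp only [RingHom.id_apply]
    rw [ProjectiveResolution.extMk_comp_mk₀]
    congr 1
    rw [map_smul]
    simp

lemma newMap_surj {M : ModuleCat.{0} R} (P : ProjectiveResolution M) (X : ModuleCat.{0} R) (i : ℕ) :
    Function.Surjective (newMap P X i) := by
  intro x
  obtain ⟨f, hf, rfl⟩ := P.extMk_surjective x (i+1) rfl
  obtain ⟨z, hz⟩ := exists_cycle (yo P X) i f hf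
  refine ⟨z, ?_⟩
  simp only [newMap, LinearMap.coe_mk, AddHom.coe_mk]
  congr 1

lemma newMap_ker {M : ModuleCat.{0} R} (P : ProjectiveResolution M) (X : ModuleCat.{0} R) (i : ℕ) :
    LinearMap.ker ((yo P X).homologyπ i).hom = LinearMap.ker (newMap P X i) := by
  ext z
  simp only [LinearMap.mem_ker]
  have h1 : newMap P X i z = 0 ↔ _ := extMk_eq_zero P X i _ (yo_cocycle P X i z)
  rw [h1]
  exact homologyπ_eq_zero _ _ _

noncomputable def cmp {M : ModuleCat.{0} R} (P : ProjectiveResolution M) (X : ModuleCat.{0} R)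
    (i : ℕ) : (yo P X).homology i ≃ₗ[R] Ext M X i :=
  ((((yo P X).homologyπ i).hom.quotKerEquivOfSurjective (homologyπ_surj _ _)).symm.trans
    (Submodule.quotEquivOfEq _ _ (newMap_ker P X i))).trans
    ((newMap P X i).quotKerEquivOfSurjective (newMap_surj P X i))

lemma cmp_apply {M : ModuleCat.{0} R} (P : ProjectiveResolution M) (X : ModuleCat.{0} R)
    (i : ℕ) (z : (yo P X).cycles i) :
    cmp P X i (((yo P X).homologyπ i).hom z) = newMap P X i z := by
  have : (((yo P X).homologyπ i).hom.quotKerEquivOfSurjective (homologyπ_surj _ _)).symm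
      (((yo P X).homologyπ i).hom z) = Submodule.Quotient.mk z := by
    rw [LinearEquiv.symm_apply_eq]
    rfl
  simp only [cmp, LinearEquiv.trans_apply, this]
  rfl

/-- functoriality of `yo` -/
noncomputable def yoMap {M M' : ModuleCat.{0} R} {P : ProjectiveResolution M}
    {P' : ProjectiveResolution M'} (φ : P'.complex ⟶ P.complex) (X : ModuleCat.{0} R) :
    yo P X ⟶ yo P' X :=
  (HomologicalComplex.unopFunctor _ _).map
    ((((linearYoneda R (ModuleCat.{0} R)).obj X).rightOp.mapHomologicalComplex _).map φ).op

lemma yoMap_cyc {M M' : ModuleCat.{0} R} {P : ProjectiveResolution M}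
    {P' : ProjectiveResolution M'} (φ : P'.complex ⟶ P.complex) (X : ModuleCat.{0} R) (i : ℕ)
    (z : (yo P X).cycles i) :
    cyc P' X i ((HomologicalComplex.cyclesMap (yoMap φ X) i).hom z) = φ.f i ≫ cyc P X i z := by
  have h := HomologicalComplex.cyclesMap_i (yoMap φ X) i
  exact congr($(h).hom z)

lemma cmp_nat {M M' : ModuleCat.{0} R} {P : ProjectiveResolution M}
    {P' : ProjectiveResolution M'} {g : M' ⟶ M} (φ : ProjectiveResolution.Hom P' P g)
    (X : ModuleCat.{0} R) (i : ℕ) (x : (yo P X).homology i) :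
    cmp P' X i ((HomologicalComplex.homologyMap (yoMap φ.hom X) i).hom x) =
      (Ext.mk₀ g).comp (cmp P X i x) (zero_add _) := by
  obtain ⟨z, rfl⟩ := homologyπ_surj _ _ x
  have h := HomologicalComplex.homologyπ_naturality (yoMap φ.hom X) i
  have h2 : (HomologicalComplex.homologyMap (yoMap φ.hom X) i).hom
      (((yo P X).homologyπ i).hom z) = ((yo P' X).homologyπ i).hom
        ((HomologicalComplex.cyclesMap (yoMap φ.hom X) i).hom z) := congr($(h).hom z)
  rw [h2, cmp_apply, cmp_apply]
  simp only [newMap, LinearMap.coe_mk, AddHom.coe_mk]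
  rw [ProjectiveResolution.mk₀_comp_extMk _ _ _ _ φ]
  congr 1
  exact yoMap_cyc _ _ _ _

lemma abs_inv {C : Type*} [Category C] {A B A' B' : C} (e : A ≅ B) (e' : A' ≅ B')
    (f : B ⟶ B') (f' : A ⟶ A') (h : f ≫ e'.inv = e.inv ≫ f') : e.hom ≫ f = f' ≫ e'.hom := by
  rw [← cancel_mono e'.inv, Category.assoc, h]
  simp

lemma abs_comp {C : Type*} [Category C] {E E' B B' D D' : C} (f : E ⟶ E') (a : E ⟶ B)
    (a' : E' ⟶ B') (c : B ⟶ D) (c' : B' ⟶ D') (β : B ⟶ B') (δ : D ⟶ D')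
    (h1 : f ≫ a' = a ≫ β) (h3 : β ≫ c' = c ≫ δ) : f ≫ (a' ≫ c') = (a ≫ c) ≫ δ := by
  rw [← Category.assoc, h1, Category.assoc, h3, Category.assoc]

lemma isoExt_nat {M M' : ModuleCat.{0} R} {P : ProjectiveResolution M}
    {P' : ProjectiveResolution M'} {g : M' ⟶ M} (φ : ProjectiveResolution.Hom P' P g)
    (X : ModuleCat.{0} R) (i : ℕ) :
    (((_root_.Ext R (ModuleCat.{0} R) i).map g.op).app X) ≫ (P'.isoExt i X).hom =
      (P.isoExt i X).hom ≫ HomologicalComplex.homologyMap (yoMap φ.hom X) i := by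
  have h1 := ProjectiveResolution.isoLeftDerivedObj_inv_naturality g P' P φ.hom
    (φ.hom_f_zero_comp_π_f_zero) ((linearYoneda R (ModuleCat.{0} R)).obj X).rightOp i
  have h2 := HomologicalComplex.homologyOp_hom_naturality (yoMap φ.hom X) i
  have h3 : ((yo P' X).homologyOp i).inv ≫ HomologicalComplex.homologyMap
      ((HomologicalComplex.opFunctor _ _).map (yoMap φ.hom X).op) _ =
      (HomologicalComplex.homologyMap (yoMap φ.hom X) i).op ≫ ((yo P X).homologyOp i).inv := by
    exact abs_inv (Iso.symm ((yo P' X).homologyOp i)) ((yo P X).homologyOp i).symm _ _ h2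
  exact abs_comp _ _ _ _ _ _ _ (congr(($h1).unop)) (congr(($h3).unop))

/-- the comparison of the two versions of `Ext` -/
noncomputable def oldNew (M X : ModuleCat.{0} R) (i : ℕ) :
    ((_root_.Ext R (ModuleCat.{0} R) i).obj (Opposite.op M)).obj X ≃ₗ[R] Ext M X i :=
  ((projectiveResolution M).isoExt i X).toLinearEquiv.trans (cmp (projectiveResolution M) X i)

lemma oldNew_nat {M M' : ModuleCat.{0} R} (g : M' ⟶ M) (X : ModuleCat.{0} R) (i : ℕ)
    (x : ((_root_.Ext R (ModuleCat.{0} R) i).obj (Opposite.op M)).obj X) :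
    oldNew M' X i ((((_root_.Ext R (ModuleCat.{0} R) i).map g.op).app X).hom x) =
      (Ext.mk₀ g).comp (oldNew M X i x) (zero_add _) := by
  let φ : ProjectiveResolution.Hom (projectiveResolution M') (projectiveResolution M) g :=
    { hom := ProjectiveResolution.lift g _ _
      hom_f_zero_comp_π_f_zero := by
        have := ProjectiveResolution.lift_commutes g (projectiveResolution M')
          (projectiveResolution M)
        exact congr(($this).f 0) }
  have h := congr($(isoExt_nat φ X i).hom x)
  refine Eq.trans ?_ (cmp_nat φ X i _)
  exact congr(cmp (projectiveResolution M') X i $h)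
open Limits localCohomology

/-- new Ext as a functor -/
noncomputable def extFun (X : ModuleCat.{0} R) (i : ℕ) : (ModuleCat.{0} R)ᵒᵖ ⥤ ModuleCat.{0} R where
  obj M := ModuleCat.of R (Ext M.unop X i)
  map {M M'} g := ModuleCat.ofHom
    { toFun := fun x => (Ext.mk₀ g.unop).comp x (zero_add _)
      map_add' := fun x y => by simp
      map_smul' := fun r x => by simp }
  map_id M := by
    ext x
    simp
  map_comp {M M' M''} f g := by
    ext x
    simp only [ModuleCat.hom_comp, LinearMap.comp_apply, ModuleCat.hom_ofHom, LinearMap.coe_mk,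
      AddHom.coe_mk, unop_comp]
    rw [← Ext.mk₀_comp_mk₀_assoc]

/-- right multiplication as a natural transformation -/
noncomputable def extTrans {X Y : ModuleCat.{0} R} {i j k : ℕ} (y : Ext X Y j) (h : i + j = k) :
    extFun X i ⟶ extFun Y k where
  app M := ModuleCat.ofHom
    { toFun := fun x => x.comp y h
      map_add' := fun x y => by simp
      map_smul' := fun r x => by simp }
  naturality M M' f := by
    ext x
    simp only [ModuleCat.hom_comp, LinearMap.comp_apply, ModuleCat.hom_ofHom, LinearMap.coe_mk,
      AddHom.coe_mk, extFun]
    exact Ext.comp_assoc _ _ _ (zero_add _) h (by omega)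

abbrev quots (a : Ideal R) : (ℕᵒᵖ)ᵒᵖ ⥤ (ModuleCat.{0} R)ᵒᵖ :=
  (ringModIdeals (idealPowersDiagram a)).op

noncomputable abbrev D (a : Ideal R) (i : ℕ) (X : ModuleCat.{0} R) : (ℕᵒᵖ)ᵒᵖ ⥤ ModuleCat.{0} R :=
  quots a ⋙ extFun X i

noncomputable def L (a : Ideal R) (i : ℕ) (X : ModuleCat.{0} R) : ModuleCat.{0} R :=
  colimit (D a i X)

noncomputable def Ltrans (a : Ideal R) {X Y : ModuleCat.{0} R} {i j k : ℕ} (y : Ext X Y j)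
    (h : i + j = k) : L a i X ⟶ L a k Y :=
  colimMap (Functor.whiskerLeft (quots a) (extTrans y h))

noncomputable def oldNewIso (X : ModuleCat.{0} R) (i : ℕ) :
    _root_.Ext R (ModuleCat.{0} R) i ⋙ (evaluation _ _).obj X ≅ extFun X i :=
  NatIso.ofComponents (fun M => (oldNew M.unop X i).toModuleIso) (by
    intro M M' f
    ext x
    exact oldNew_nat f.unop X i x)

noncomputable def lcIso (a : Ideal R) (i : ℕ) (X : ModuleCat.{0} R) :
    (localCohomology a i).obj X ≅ L a i X :=
  colimitObjIsoColimitCompEvaluation (diagram (idealPowersDiagram a) i) X ≪≫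
    HasColimit.isoOfNatIso (Functor.isoWhiskerLeft (quots a) (oldNewIso X i))

lemma colimMap_exact {J : Type} [SmallCategory J] [IsFiltered J] {F G H : J ⥤ ModuleCat.{0} R}
    (α : F ⟶ G) (β : G ⟶ H) (h : ∀ j, Function.Exact (α.app j).hom (β.app j).hom) :
    Function.Exact (colimMap α).hom (colimMap β).hom := by
  intro y
  constructor
  · intro hy
    obtain ⟨j, y, rfl⟩ := Concrete.colimit_exists_rep G y
    have h1 : (colimMap β).hom ((colimit.ι G j).hom y) = (colimit.ι H j).hom ((β.app j).hom y) :=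
      congr($(ι_colimMap β j).hom y)
    change (colimMap β).hom ((colimit.ι G j).hom y) = 0 at hy
    rw [h1] at hy
    obtain ⟨k, f, hk⟩ := Concrete.colimit_rep_eq_zero (R := R) (F := H) (hx := hy)
    have h2 : (β.app k).hom ((G.map f).hom y) = 0 := by
      rw [← hk]
      exact congr($(β.naturality f).hom y)
    obtain ⟨x, hx⟩ := (h k _).1 h2
    refine ⟨(colimit.ι F k).hom x, ?_⟩
    have h3 : (colimMap α).hom ((colimit.ι F k).hom x) = (colimit.ι G k).hom ((α.app k).hom x) :=
      congr($(ι_colimMap α k).hom x)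
    rw [h3, hx]
    exact congr($(colimit.w G f).hom y)
  · rintro ⟨x, rfl⟩
    obtain ⟨j, x, rfl⟩ := Concrete.colimit_exists_rep F x
    have h3 : (colimMap α).hom ((colimit.ι F j).hom x) = (colimit.ι G j).hom ((α.app j).hom x) :=
      congr($(ι_colimMap α j).hom x)
    have h1 : ∀ y, (colimMap β).hom ((colimit.ι G j).hom y) = (colimit.ι H j).hom ((β.app j).hom y) :=
      fun y => congr($(ι_colimMap β j).hom y)
    refine (congr((colimMap β).hom $h3)).trans ?_
    rw [h1, (h j).apply_apply_eq_zero, map_zero]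

lemma zero₁ {S : ShortComplex (ModuleCat.{0} R)} (hS : S.ShortExact) (i : ℕ)
    (M : ModuleCat.{0} R) (y : Ext M S.X₃ i) :
    (y.comp hS.extClass rfl).comp (Ext.mk₀ S.f) (add_zero (i+1)) = 0 := by
  rw [Ext.comp_assoc _ _ _ rfl (add_zero 1) (by omega), hS.extClass_comp, Ext.comp_zero]

lemma zero₂ {S : ShortComplex (ModuleCat.{0} R)} (i : ℕ)
    (M : ModuleCat.{0} R) (y : Ext M S.X₁ i) :
    (y.comp (Ext.mk₀ S.f) (add_zero i)).comp (Ext.mk₀ S.g) (add_zero (i)) = 0 := by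
  rw [Ext.comp_assoc _ _ _ (add_zero i) (add_zero 0) (by omega), Ext.mk₀_comp_mk₀, S.zero]
  simp

lemma zero₃ {S : ShortComplex (ModuleCat.{0} R)} (hS : S.ShortExact) (i : ℕ)
    (M : ModuleCat.{0} R) (y : Ext M S.X₂ i) :
    (y.comp (Ext.mk₀ S.g) (add_zero i)).comp hS.extClass rfl = 0 := by
  rw [Ext.comp_assoc _ _ _ (add_zero i) (zero_add 1) (by omega), hS.comp_extClass, Ext.comp_zero]

lemma L_exact₁ (a : Ideal R) {S : ShortComplex (ModuleCat.{0} R)} (hS : S.ShortExact) (i : ℕ) :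
    Function.Exact (Ltrans a (i := i) hS.extClass rfl).hom
      (Ltrans a (Ext.mk₀ S.f) (add_zero (i+1))).hom := by
  apply colimMap_exact
  intro M x
  constructor
  · intro h
    exact Ext.covariant_sequence_exact₁ _ hS x h rfl
  · rintro ⟨y, rfl⟩
    change (y.comp hS.extClass rfl).comp (Ext.mk₀ S.f) (add_zero (i+1)) = 0
    exact zero₁ hS i _ y

lemma L_exact₂ (a : Ideal R) {S : ShortComplex (ModuleCat.{0} R)} (hS : S.ShortExact) (i : ℕ) :
    Function.Exact (Ltrans a (Ext.mk₀ S.f) (add_zero i)).hom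
      (Ltrans a (Ext.mk₀ S.g) (add_zero i)).hom := by
  apply colimMap_exact
  intro M x
  constructor
  · intro h
    exact Ext.covariant_sequence_exact₂ _ hS x h
  · rintro ⟨y, rfl⟩
    change (y.comp (Ext.mk₀ S.f) (add_zero i)).comp (Ext.mk₀ S.g) (add_zero (i)) = 0
    exact zero₂ i _ y

lemma L_exact₃ (a : Ideal R) {S : ShortComplex (ModuleCat.{0} R)} (hS : S.ShortExact) (i : ℕ) :
    Function.Exact (Ltrans a (Ext.mk₀ S.g) (add_zero i)).hom
      (Ltrans a (i := i) hS.extClass rfl).hom := by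
  apply colimMap_exact
  intro M x
  constructor
  · intro h
    exact Ext.covariant_sequence_exact₃ _ hS x rfl h
  · rintro ⟨y, rfl⟩
    change (y.comp (Ext.mk₀ S.g) (add_zero i)).comp hS.extClass rfl = 0
    exact zero₃ hS i _ y

lemma L_inj (a : Ideal R) (X : ModuleCat.{0} R) [Injective X] (i : ℕ) :
    Subsingleton (L a (i+1) X) := by
  refine ⟨fun x y => ?_⟩
  have key : ∀ z : L a (i+1) X, z = 0 := by
    intro z
    obtain ⟨j, z, rfl⟩ := Concrete.colimit_exists_rep (D a (i+1) X) z
    have : z = 0 := Ext.eq_zero_of_injective z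
    rw [this]
    exact map_zero _
  rw [key x, key y]

lemma L_congr (a : Ideal R) {X Y : ModuleCat.{0} R} (e : X ≅ Y) (i : ℕ)
    (h : Subsingleton (L a i X)) : Subsingleton (L a i Y) := by
  let e' := (lcIso a i Y).symm ≪≫ (localCohomology a i).mapIso e.symm ≪≫ lcIso a i X
  exact e'.toLinearEquiv.toEquiv.subsingleton

/-- evaluation of a degree zero class at an element -/
noncomputable def ev {M : ModuleCat.{0} R} (m : M) (X : ModuleCat.{0} R) : Ext M X 0 →ₗ[R] X where
  toFun x := (Ext.linearEquiv₀ (R := R) x).hom m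
  map_add' x y := by simp
  map_smul' r x := by simp

lemma ev_mk₀ {M : ModuleCat.{0} R} (m : M) {X : ModuleCat.{0} R} (f : M ⟶ X) :
    ev m X (Ext.mk₀ f) = f.hom m := by
  have : Ext.linearEquiv₀ (R := R) (Ext.mk₀ f) = f := by
    apply (Ext.linearEquiv₀ (R := R)).symm.injective
    simp
  simp [ev, this]

lemma exists_mk₀ {M X : ModuleCat.{0} R} (x : Ext M X 0) : ∃ f : M ⟶ X, x = Ext.mk₀ f :=
  ⟨Ext.linearEquiv₀ (R := R) x, by simp⟩

lemma ev_precomp {M M' : ModuleCat.{0} R} (m : M') (g : M' ⟶ M) (X : ModuleCat.{0} R)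
    (x : Ext M X 0) : ev m X ((Ext.mk₀ g).comp x (zero_add 0)) = ev (g.hom m) X x := by
  obtain ⟨f, rfl⟩ := exists_mk₀ x
  rw [Ext.mk₀_comp_mk₀, ev_mk₀, ev_mk₀]
  simp

lemma ev_postcomp {M : ModuleCat.{0} R} (m : M) {X Y : ModuleCat.{0} R} (f : X ⟶ Y)
    (x : Ext M X 0) : ev m Y (x.comp (Ext.mk₀ f) (add_zero 0)) = f.hom (ev m X x) := by
  obtain ⟨g, rfl⟩ := exists_mk₀ x
  rw [Ext.mk₀_comp_mk₀, ev_mk₀, ev_mk₀]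
  simp

abbrev one (a : Ideal R) (j : (ℕᵒᵖ)ᵒᵖ) : ((quots a).obj j).unop :=
  (Ideal.Quotient.mk (a ^ j.unop.unop) 1 : R ⧸ a ^ j.unop.unop)

noncomputable def epsCocone (a : Ideal R) (X : ModuleCat.{0} R) : Cocone (D a 0 X) where
  pt := X
  ι :=
    { app := fun j => ModuleCat.ofHom (ev (one a j) X)
      naturality := fun j k f => by
        ext x
        exact ev_precomp (one a k) ((quots a).map f).unop X x }

noncomputable def eps (a : Ideal R) (X : ModuleCat.{0} R) : L a 0 X ⟶ X :=
  colimit.desc _ (epsCocone a X)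

lemma eps_ι (a : Ideal R) (X : ModuleCat.{0} R) (j : (ℕᵒᵖ)ᵒᵖ) (x : (D a 0 X).obj j) :
    (eps a X).hom ((colimit.ι (D a 0 X) j).hom x) = ev (one a j) X x :=
  congr($(colimit.ι_desc (epsCocone a X) j).hom x)

lemma eps_nat (a : Ideal R) {X Y : ModuleCat.{0} R} (f : X ⟶ Y) (x : L a 0 X) :
    (eps a Y).hom ((Ltrans a (Ext.mk₀ f) (add_zero 0)).hom x) = f.hom ((eps a X).hom x) := by
  obtain ⟨j, x, rfl⟩ := Concrete.colimit_exists_rep (D a 0 X) x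
  have h3 : (Ltrans a (Ext.mk₀ f) (add_zero 0)).hom ((colimit.ι (D a 0 X) j).hom x) =
      (colimit.ι (D a 0 Y) j).hom (((extTrans (Ext.mk₀ f) (add_zero 0)).app _).hom x) :=
    congr($(ι_colimMap (Functor.whiskerLeft (quots a) (extTrans (Ext.mk₀ f) (add_zero 0))) j).hom x)
  refine (congr((eps a Y).hom $h3)).trans ?_
  rw [eps_ι]
  refine Eq.trans ?_ (congr(f.hom $(eps_ι a X j x))).symm
  exact ev_postcomp _ _ _

lemma ev_one_inj (I : Ideal R) (X : ModuleCat.{0} R) (x : Ext (ModuleCat.of R (R ⧸ I)) X 0)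
    (h : ev (M := ModuleCat.of R (R ⧸ I)) (Ideal.Quotient.mk I 1) X x = 0) : x = 0 := by
  obtain ⟨f, rfl⟩ := exists_mk₀ x
  rw [ev_mk₀] at h
  have : f = 0 := by
    apply ModuleCat.hom_ext
    apply LinearMap.ext
    intro y
    obtain ⟨r, rfl⟩ := Ideal.Quotient.mk_surjective y
    have e : Ideal.Quotient.mk I r = r • Ideal.Quotient.mk I 1 := by
      rw [Algebra.smul_def]; simp
    have := f.hom.map_smul r (Ideal.Quotient.mk I 1)
    rw [e]
    refine this.trans ?_
    rw [h]
    simp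
  rw [this]; simp

lemma eps_inj (a : Ideal R) (X : ModuleCat.{0} R) : Function.Injective (eps a X).hom := by
  rw [injective_iff_map_eq_zero]
  intro x hx
  obtain ⟨j, x, rfl⟩ := Concrete.colimit_exists_rep (D a 0 X) x
  have h := (eps_ι a X j x).symm.trans hx
  have : x = 0 := ev_one_inj _ X x h
  rw [this]
  exact map_zero _

lemma eps_range (a : Ideal R) (X : ModuleCat.{0} R) (x : X) :
    x ∈ LinearMap.range (eps a X).hom ↔ ∃ n : ℕ, ∀ r ∈ a ^ n, r • x = 0 := by
  constructor
  · rintro ⟨x, rfl⟩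
    obtain ⟨j, x, rfl⟩ := Concrete.colimit_exists_rep (D a 0 X) x
    refine ⟨j.unop.unop, fun r hr => ?_⟩
    have h := eps_ι a X j x
    refine (congr(r • $h)).trans ?_
    refine ((ev (one a j) X).map_smul r x).symm.trans ?_
    have key : ∀ x : Ext (ModuleCat.of R (R ⧸ a ^ j.unop.unop)) X 0, 
        ev (M := ModuleCat.of R (R ⧸ a ^ j.unop.unop)) 
          (Ideal.Quotient.mk (a ^ j.unop.unop) 1) X (r • x) = 0 := by
      intro x
      obtain ⟨f, rfl⟩ := exists_mk₀ x
      rw [map_smul, ev_mk₀, ← map_smul]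
      have : (r • (Ideal.Quotient.mk (a ^ j.unop.unop) 1) : R ⧸ a ^ j.unop.unop) = 0 := by
        rw [Algebra.smul_def]; simpa using Ideal.Quotient.eq_zero_iff_mem.2 hr
      exact (congr(f.hom $this)).trans (map_zero _)
    exact key x
  · rintro ⟨n, hn⟩
    let f : ModuleCat.of R (R ⧸ a ^ n) ⟶ X := ModuleCat.ofHom
      ((a ^ n).liftQ (LinearMap.toSpanSingleton R X x) (by
        intro r hr
        exact hn r hr))
    refine ⟨(colimit.ι (D a 0 X) (Opposite.op (Opposite.op n))).hom (Ext.mk₀ f), ?_⟩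
    refine (eps_ι a X _ _).trans ?_
    refine (ev_mk₀ _ f).trans ?_
    exact ((a ^ n).liftQ_apply _ _).trans (one_smul R x)

lemma L0_injective [IsNoetherianRing R] (b : Ideal R) (X : ModuleCat.{0} R) [Injective X] :
    Injective (L b 0 X) := by
  have hX : Module.Injective R X := Module.injective_module_of_injective_object R X
  suffices h : Module.Injective R (L b 0 X) from
    (Module.injective_iff_injective_object R (L b 0 X)).1 h
  apply Module.Baer.injective
  intro c f
  let ε := (eps b X).hom
  -- a power of `b` kills the image of `f`
  have hn : ∃ n : ℕ, ∀ r ∈ b ^ n, ∀ y : c, r • f y = 0 := by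
    have hfg : (⊤ : Submodule R c).FG := Module.Finite.fg_top
    obtain ⟨s, hs⟩ := hfg
    have h1 : ∀ y : c, ∃ n : ℕ, ∀ r ∈ b ^ n, r • f y = 0 := by
      intro y
      obtain ⟨n, hn⟩ := (eps_range b X (ε (f y))).1 ⟨_, rfl⟩
      refine ⟨n, fun r hr => ?_⟩
      apply eps_inj b X
      rw [map_smul, map_zero]
      exact hn r hr
    choose N hN using h1
    refine ⟨s.sup N, fun r hr y => ?_⟩
    have hy : y ∈ Submodule.span R (s : Set c) := by rw [hs]; trivial
    induction hy using Submodule.span_induction with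
    | mem y hy => exact hN y r (Ideal.pow_le_pow_right (Finset.le_sup hy) hr)
    | zero => simp
    | add y z _ _ h1 h2 => rw [map_add, smul_add, h1, h2, add_zero]
    | smul t y _ h => rw [map_smul, smul_comm, h, smul_zero]
  obtain ⟨n, hn⟩ := hn
  obtain ⟨k, hk⟩ := Ideal.exists_pow_inf_eq_pow_smul b (N := (c : Submodule R R))
  have hk' := hk (n + k) (by omega)
  set m := n + k
  let g : c →ₗ[R] (R ⧸ b ^ m) := (b ^ m).mkQ ∘ₗ c.subtype
  have hker : LinearMap.ker g ≤ LinearMap.ker (ε ∘ₗ f) := by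
    intro y hy
    have hy1 : (y : R) ∈ b ^ m := by
      simpa [g, Ideal.Quotient.eq_zero_iff_mem] using hy
    have hy2 : (y : R) ∈ b ^ (m - k) • (b ^ k • (⊤ : Submodule R R) ⊓ c) := by
      rw [← hk']
      exact ⟨by simpa using hy1, y.2⟩
    have hy3 : (y : R) ∈ b ^ n • c := by
      have : m - k = n := by omega
      rw [this] at hy2
      exact Submodule.smul_mono le_rfl inf_le_right hy2
    have h4 : ∀ z ∈ b ^ n • c, ∃ hz : z ∈ c, f ⟨z, hz⟩ = 0 := by
      intro z hz
      refine Submodule.smul_induction_on hz ?_ ?_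
      · intro r hr w hw
        refine ⟨c.smul_mem r hw, ?_⟩
        have : (⟨r • w, c.smul_mem r hw⟩ : c) = r • ⟨w, hw⟩ := rfl
        rw [this, map_smul]
        exact hn r hr _
      · rintro z w ⟨hz, hz'⟩ ⟨hw, hw'⟩
        refine ⟨c.add_mem hz hw, ?_⟩
        have : (⟨z + w, c.add_mem hz hw⟩ : c) = ⟨z, hz⟩ + ⟨w, hw⟩ := rfl
        rw [this, map_add, hz', hw', add_zero]
    obtain ⟨hz, h5⟩ := h4 y hy3
    simp only [LinearMap.mem_ker, LinearMap.comp_apply]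
    rw [show f y = 0 from h5, map_zero]
  let h : LinearMap.range g →ₗ[R] X :=
    (LinearMap.ker g).liftQ (ε ∘ₗ f) hker ∘ₗ g.quotKerEquivRange.symm.toLinearMap
  have hh : ∀ y : c, h ⟨g y, y, rfl⟩ = ε (f y) := by
    intro y
    have : g.quotKerEquivRange.symm ⟨g y, y, rfl⟩ = Submodule.Quotient.mk y := by
      rw [LinearEquiv.symm_apply_eq]
      rfl
    simp [h, this]
  obtain ⟨H, hH⟩ := hX.out (LinearMap.range g).subtype (Submodule.subtype_injective _) h
  have hm : ∀ r : R, r • H (Submodule.Quotient.mk 1) = H ((b ^ m).mkQ r) := by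
    intro r
    rw [← map_smul, ← Submodule.Quotient.mk_smul]
    simp
  obtain ⟨w, hw⟩ := (eps_range b X (H (Submodule.Quotient.mk 1))).2 ⟨m, fun r hr => by
    rw [hm, Submodule.mkQ_apply, (Submodule.Quotient.mk_eq_zero _).2 hr, map_zero]⟩
  refine ⟨LinearMap.toSpanSingleton R _ w, fun r hr => ?_⟩
  apply eps_inj b X
  rw [LinearMap.toSpanSingleton_apply, map_smul, hw, hm]
  refine Eq.trans ?_ (hh ⟨r, hr⟩)
  exact hH ⟨g ⟨r, hr⟩, ⟨r, hr⟩, rfl⟩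

lemma subsing_of_exact {A B C : ModuleCat.{0} R} {f : A ⟶ B} {g : B ⟶ C}
    (h : Function.Exact f.hom g.hom) (hA : Subsingleton A) (hC : Subsingleton C) :
    Subsingleton B := by
  have key : ∀ y : B, y = 0 := by
    intro y
    obtain ⟨x, rfl⟩ := (h y).1 (Subsingleton.elim _ _)
    rw [Subsingleton.elim x 0, map_zero]
  exact ⟨fun x y => by rw [key x, key y]⟩

lemma sub_of_f {A B C : ModuleCat.{0} R} {f : A ⟶ B} {g : B ⟶ C}
    (h : Function.Exact f.hom g.hom) (hC : Subsingleton C) : Function.Surjective f.hom :=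
  fun y => (h y).1 (Subsingleton.elim _ _)

lemma inj_of_g {A B C : ModuleCat.{0} R} {f : A ⟶ B} {g : B ⟶ C}
    (h : Function.Exact f.hom g.hom) (hA : Subsingleton A) : Function.Injective g.hom := by
  rw [injective_iff_map_eq_zero]
  intro y hy
  obtain ⟨x, rfl⟩ := (h y).1 hy
  rw [Subsingleton.elim x 0, map_zero]

/-- dimension shifting -/
lemma shift (b : Ideal R) {S : ShortComplex (ModuleCat.{0} R)} (hS : S.ShortExact)
    [Injective S.X₂] (r : ℕ) : Nonempty (L b (r+1) S.X₃ ≅ L b (r+1+1) S.X₁) :=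
  ⟨(LinearEquiv.ofBijective (Ltrans b (i := r+1) hS.extClass rfl).hom
    ⟨inj_of_g (L_exact₃ b hS (r+1)) (L_inj b S.X₂ r),
     sub_of_f (L_exact₁ b hS (r+1)) (L_inj b S.X₂ (r+1))⟩).toModuleIso⟩

lemma shortExact_of {A B C : ModuleCat.{0} R} (f : A ⟶ B) (g : B ⟶ C) (hfg : f ≫ g = 0)
    (h : Function.Exact f.hom g.hom) (hf : Function.Injective f.hom)
    (hg : Function.Surjective g.hom) : (ShortComplex.mk f g hfg).ShortExact where
  exact := by
    rw [ShortComplex.moduleCat_exact_iff]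
    exact fun x hx => (h x).1 hx
  mono_f := (ModuleCat.mono_iff_injective _).2 hf
  epi_g := (ModuleCat.epi_iff_surjective _).2 hg

noncomputable abbrev Lm (a : Ideal R) {X Y : ModuleCat.{0} R} (f : X ⟶ Y) (i : ℕ) : L a i X ⟶ L a i Y :=
  Ltrans a (Ext.mk₀ f) (add_zero i)

/-- The four term exact sequence, cut in two. -/
lemma cut (b : Ideal R) {S : ShortComplex (ModuleCat.{0} R)} (hS : S.ShortExact)
    [Injective S.X₂] : ∃ (C : ModuleCat.{0} R) (p : L b 0 S.X₂ ⟶ C) (q : C ⟶ L b 0 S.X₃)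
      (d : L b 0 S.X₃ ⟶ L b 1 S.X₁) (h1 : Lm b S.f 0 ≫ p = 0) (h2 : q ≫ d = 0),
      (ShortComplex.mk _ _ h1).ShortExact ∧ (ShortComplex.mk _ _ h2).ShortExact ∧
      p ≫ q = Lm b S.g 0 := by
  have e2 := L_exact₂ b hS 0
  have e3 := L_exact₃ b hS 0
  have e1 := L_exact₁ b hS 0
  let N := LinearMap.range (Lm b S.g 0).hom
  let p : L b 0 S.X₂ ⟶ ModuleCat.of R N := ModuleCat.ofHom (Lm b S.g 0).hom.rangeRestrict
  let q : ModuleCat.of R N ⟶ L b 0 S.X₃ := ModuleCat.ofHom N.subtype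
  let d : L b 0 S.X₃ ⟶ L b 1 S.X₁ := Ltrans b (i := 0) hS.extClass rfl
  have h1 : Lm b S.f 0 ≫ p = 0 := by
    apply ModuleCat.hom_ext
    apply LinearMap.ext
    intro x
    apply Subtype.ext
    exact e2.apply_apply_eq_zero x
  have h2 : q ≫ d = 0 := by
    apply ModuleCat.hom_ext
    apply LinearMap.ext
    rintro ⟨_, x, rfl⟩
    exact e3.apply_apply_eq_zero x
  refine ⟨ModuleCat.of R N, p, q, d, h1, h2, shortExact_of _ _ _ ?_ ?_ ?_,
    shortExact_of _ _ _ ?_ ?_ ?_, rfl⟩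
  · intro x
    refine Iff.trans ?_ (e2 x)
    exact Subtype.ext_iff
  · intro x y hxy
    apply eps_inj
    have hf : Function.Injective S.f.hom := (ModuleCat.mono_iff_injective _).1 hS.mono_f
    apply hf
    rw [← eps_nat, ← eps_nat]
    exact congr((eps b S.X₂).hom $hxy)
  · exact LinearMap.surjective_rangeRestrict _
  · intro x
    refine (e3 x).trans ?_
    constructor
    · intro h
      exact ⟨⟨x, h⟩, rfl⟩
    · rintro ⟨y, rfl⟩
      exact y.2
  · exact Subtype.val_injective
  · exact sub_of_f e1 (L_inj b S.X₂ 0)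

lemma tors_lift (a b : Ideal R) (X : ModuleCat.{0} R) (x : L (a + b) 0 X) :
    ∃ w : L a 0 (L b 0 X), (eps b X).hom ((eps a _).hom w) = (eps (a+b) X).hom x := by
  obtain ⟨n, hn⟩ := (eps_range (a+b) X ((eps (a+b) X).hom x)).1 ⟨x, rfl⟩
  obtain ⟨y, hy⟩ := (eps_range b X ((eps (a+b) X).hom x)).2
    ⟨n, fun r hr => hn r (Ideal.pow_right_mono le_sup_right n hr)⟩
  obtain ⟨w, hw⟩ := (eps_range a _ y).2 ⟨n, fun r hr => by
    apply eps_inj b X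
    rw [map_smul, hy, map_zero]
    exact hn r (Ideal.pow_right_mono le_sup_left n hr)⟩
  exact ⟨w, by rw [hw, hy]⟩

lemma tors_desc (a b : Ideal R) (X : ModuleCat.{0} R) (w : L a 0 (L b 0 X)) :
    ∃ x : L (a + b) 0 X, (eps b X).hom ((eps a _).hom w) = (eps (a+b) X).hom x := by
  obtain ⟨n, hn⟩ := (eps_range a _ ((eps a _).hom w)).1 ⟨w, rfl⟩
  obtain ⟨m, hm⟩ := (eps_range b X ((eps b X).hom ((eps a _).hom w))).1 ⟨_, rfl⟩
  obtain ⟨x, hx⟩ := (eps_range (a+b) X ((eps b X).hom ((eps a _).hom w))).2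
    ⟨n + m, fun r hr => by
      have := Ideal.sup_pow_add_le_pow_sup_pow hr
      obtain ⟨s, hs, t, ht, rfl⟩ := Submodule.mem_sup.1 this
      rw [add_smul, hm t ht, ← map_smul, hn s hs, map_zero, add_zero]⟩
  exact ⟨x, hx.symm⟩

theorem main [IsNoetherianRing R] (a b : Ideal R) (t : ℕ) : ∀ X : ModuleCat.{0} R,
    (∀ r, r ≤ t → Subsingleton (L a (t - r) (L b r X))) → Subsingleton (L (a + b) t X) := by
  induction t with
  | zero =>
    intro X h
    have h0 : Subsingleton (L a 0 (L b 0 X)) := h 0 le_rfl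
    have key : ∀ x : L (a + b) 0 X, x = 0 := by
      intro x
      obtain ⟨w, hw⟩ := tors_lift a b X x
      apply eps_inj
      rw [← hw, Subsingleton.elim w 0, map_zero, map_zero, map_zero]
    exact ⟨fun x y => by rw [key x, key y]⟩
  | succ t ih =>
    intro X h
    let S : ShortComplex (ModuleCat.{0} R) :=
      ShortComplex.mk (Injective.ι X) (cokernel.π (Injective.ι X)) (cokernel.condition _)
    have hS : S.ShortExact :=
      { exact := ShortComplex.exact_cokernel _
        mono_f := by dsimp [S]; infer_instance
        epi_g := by dsimp [S]; infer_instance }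
    haveI : Injective S.X₂ := by dsimp [S]; infer_instance
    change ∀ r, r ≤ t + 1 → Subsingleton (L a (t + 1 - r) (L b r S.X₁)) at h
    change Subsingleton (L (a + b) (t+1) S.X₁)
    generalize S = S at *
    obtain ⟨C, p, q, d, h1, h2, hS1, hS2, hpq⟩ := cut b hS
    have hr0 : Subsingleton (L a (t+1) (L b 0 S.X₁)) := h 0 (by omega)
    have hr1 : Subsingleton (L a t (L b 1 S.X₁)) := h 1 (by omega)
    cases t with
    | zero =>
      have key : ∀ z : L (a + b) (0 + 1) S.X₁, z = 0 := by
        intro z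
        obtain ⟨z3, rfl⟩ := sub_of_f (L_exact₁ (a+b) hS 0) (L_inj (a+b) S.X₂ 0) z
        obtain ⟨w, hw⟩ := tors_lift a b S.X₃ z3
        obtain ⟨w', rfl⟩ := sub_of_f (L_exact₂ a hS2 0) hr1 w
        obtain ⟨w'', rfl⟩ := sub_of_f (L_exact₃ a hS1 0) hr0 w'
        obtain ⟨v, hv⟩ := tors_desc a b S.X₂ w''
        have : z3 = (Lm (a+b) S.g 0).hom v := by
          apply eps_inj
          rw [eps_nat, ← hv, ← hw]
          refine (congr((eps b S.X₃).hom $(eps_nat a q _))).trans ?_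
          refine (congr((eps b S.X₃).hom (q.hom $(eps_nat a p w'')))).trans ?_
          refine Eq.trans ?_ (eps_nat b S.g _)
          exact congr((eps b S.X₃).hom (($hpq).hom ((eps a _).hom w'')))
        rw [this]
        exact (L_exact₃ (a+b) hS 0).apply_apply_eq_zero v
      exact ⟨fun x y => by rw [key x, key y]⟩
    | succ t =>
      obtain ⟨e⟩ := shift (a + b) hS t
      have : Subsingleton (L (a + b) (t+1) S.X₃) := by
        apply ih
        intro r hr
        cases r with
        | zero =>
          haveI := L0_injective b S.X₂
          have hC : Subsingleton (L a (t+1) C) :=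
            subsing_of_exact (L_exact₃ a hS1 (t+1)) (L_inj a (L b 0 S.X₂) t) hr0
          exact subsing_of_exact (L_exact₂ a hS2 (t+1)) hC hr1
        | succ r =>
          obtain ⟨e⟩ := shift b hS r
          have := h (r+1+1) (by omega)
          rw [show t + 1 + 1 - (r+1+1) = t + 1 - (r + 1) by omega] at this
          exact L_congr a e.symm _ this
      exact e.symm.toLinearEquiv.toEquiv.subsingleton

end LCAux

/-- Let `R` be a commutative noetherian ring, `a, b` ideals of `R`, `X` an
`R`-module and `t ≥ 0` such that `H^{t-r}_a(H^r_b(X)) = 0` for all `0 ≤ r ≤ t`.  Then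
`H^t_{a+b}(X) = 0`. -/
theorem statement0 {R : Type} [CommRing R] [IsNoetherianRing R] (a b : Ideal R)
    (X : ModuleCat R) (t : ℕ)
    (h : ∀ r, r ≤ t →
      Subsingleton ((localCohomology a (t - r)).obj ((localCohomology b r).obj X))) :
    Subsingleton ((localCohomology (a + b) t).obj X) := by
  have : Subsingleton (LCAux.L (a + b) t X) := by
    apply LCAux.main
    intro r hr
    have h1 := h r hr
    refine LCAux.L_congr a (LCAux.lcIso b r X) _ ?_
    exact (LCAux.lcIso a (t - r) _).symm.toLinearEquiv.toEquiv.subsingleton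
  exact (LCAux.lcIso (a + b) t X).toLinearEquiv.toEquiv.subsingleton
end

section
/- Let R be a commutative noetherian ring, let a and b be ideals of R, and let M be a finitely generated R-module. Then cd(a+b, M) ≤ cd(a, M) + cd(b, M). -/
open CategoryTheory

/-- The cohomological dimension `cd(a, X) = sup {i | H^i_a(X) ≠ 0}` of an `R`-module `X`
with respect to an ideal `a`. -/
noncomputable def cohDim {R : Type} [CommRing R] (a : Ideal R) (X : ModuleCat R) : ℕ :=
  sSup {i : ℕ | Nontrivial ((localCohomology a i).obj X)}

namespace LC
open Opposite Limits

noncomputable section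

variable {R : Type} [CommRing R]

abbrev yF (Y : ModuleCat.{0} R) : ModuleCat.{0} R ⥤ (ModuleCat.{0} R)ᵒᵖ :=
  ((linearYoneda R (ModuleCat.{0} R)).obj Y).rightOp

abbrev cx {X : ModuleCat.{0} R} (P : ProjectiveResolution X) (Y : ModuleCat.{0} R) :
    ChainComplex (ModuleCat.{0} R)ᵒᵖ ℕ :=
  ((yF Y).mapHomologicalComplex _).obj P.complex

abbrev oldExt (X Y : ModuleCat.{0} R) (n : ℕ) : ModuleCat.{0} R :=
  ((Ext R (ModuleCat.{0} R) n).obj (op X)).obj Y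


abbrev iso0 {X : ModuleCat.{0} R} (P : ProjectiveResolution X) (Y : ModuleCat.{0} R) (n : ℕ) :
    ((yF Y).leftDerived n).obj X ≅ (cx P Y).homology n := P.isoLeftDerivedObj (yF Y) n

def al {X : ModuleCat.{0} R} (P : ProjectiveResolution X) (Y : ModuleCat.{0} R) (n : ℕ) :
    ((cx P Y).opcycles n).unop ⟶ oldExt X Y n :=
  ((iso0 P Y n).hom ≫ (cx P Y).homologyι n).unop

def be {X : ModuleCat.{0} R} (P : ProjectiveResolution X) (Y : ModuleCat.{0} R) (n : ℕ) :
    ((cx P Y).opcycles n).unop ⟶ ModuleCat.of R (P.complex.X n ⟶ Y) :=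
  ((cx P Y).pOpcycles n).unop

instance {X : ModuleCat.{0} R} (P : ProjectiveResolution X) (Y : ModuleCat.{0} R) (n : ℕ) :
    Epi (al P Y n) :=
  inferInstanceAs (Epi ((iso0 P Y n).hom ≫ (cx P Y).homologyι n).unop)
instance {X : ModuleCat.{0} R} (P : ProjectiveResolution X) (Y : ModuleCat.{0} R) (n : ℕ) :
    Mono (be P Y n) :=
  inferInstanceAs (Mono ((cx P Y).pOpcycles n).unop)

lemma al_nat {X X' : ModuleCat.{0} R} (P : ProjectiveResolution X) (P' : ProjectiveResolution X')
    (Y : ModuleCat.{0} R) (n : ℕ) {g : X' ⟶ X} (φ : ProjectiveResolution.Hom P' P g) :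
    al P Y n ≫ ((Ext R (ModuleCat.{0} R) n).map g.op).app Y =
      (HomologicalComplex.opcyclesMap (((yF Y).mapHomologicalComplex _).map φ.hom) n).unop ≫
        al P' Y n := by
  have h : ((yF Y).leftDerived n).map g ≫ (iso0 P Y n).hom = (iso0 P' Y n).hom ≫
      HomologicalComplex.homologyMap (((yF Y).mapHomologicalComplex _).map φ.hom) n :=
    ProjectiveResolution.isoLeftDerivedObj_hom_naturality g P' P φ.hom
      φ.hom_f_zero_comp_π_f_zero (yF Y) n
  have h2 := HomologicalComplex.homologyι_naturality
    (((yF Y).mapHomologicalComplex _).map φ.hom) n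
  have h3 : ((yF Y).leftDerived n).map g ≫ ((iso0 P Y n).hom ≫ (cx P Y).homologyι n) =
      ((iso0 P' Y n).hom ≫ (cx P' Y).homologyι n) ≫
        HomologicalComplex.opcyclesMap (((yF Y).mapHomologicalComplex _).map φ.hom) n := by
    rw [← Category.assoc, h, Category.assoc, Category.assoc, h2]
  exact congrArg Quiver.Hom.unop h3

lemma be_nat {X X' : ModuleCat.{0} R} (P : ProjectiveResolution X) (P' : ProjectiveResolution X')
    (Y : ModuleCat.{0} R) (n : ℕ) {g : X' ⟶ X} (φ : ProjectiveResolution.Hom P' P g)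
    (c : ((cx P Y).opcycles n).unop) :
    be P' Y n ((HomologicalComplex.opcyclesMap
      (((yF Y).mapHomologicalComplex _).map φ.hom) n).unop c) = φ.hom.f n ≫ (be P Y n c) := by
  have h2 := congrArg Quiver.Hom.unop <| HomologicalComplex.p_opcyclesMap
    (((yF Y).mapHomologicalComplex _).map φ.hom) n
  exact congrArg (fun k => k.hom c) h2

lemma be_range {X : ModuleCat.{0} R} (P : ProjectiveResolution X) (Y : ModuleCat.{0} R) (n : ℕ)
    (f : P.complex.X n ⟶ Y) : (∃ c, be P Y n c = f) ↔ P.complex.d (n+1) n ≫ f = 0 := by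
  have h := ShortComplex.Exact.unop (S := ShortComplex.mk _ _
      ((cx P Y).d_pOpcycles (n+1) n)) (ShortComplex.exact_of_g_is_cokernel _
    ((cx P Y).opcyclesIsCokernel (n+1) n (by simp)))
  rw [ShortComplex.ShortExact.moduleCat_exact_iff_function_exact] at h
  exact (h f).symm

lemma al_zero {X : ModuleCat.{0} R} (P : ProjectiveResolution X) (Y : ModuleCat.{0} R) (p : ℕ)
    (c : ((cx P Y).opcycles (p+1)).unop) :
    al P Y (p+1) c = 0 ↔ ∃ g, P.complex.d (p+1) p ≫ g = be P Y (p+1) c := by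
  have h := ShortComplex.Exact.unop (S := ShortComplex.mk _ _
      ((cx P Y).homologyι_comp_fromOpcycles (p+1) p)) (ShortComplex.exact_of_f_is_kernel _
    ((cx P Y).homologyIsKernel (p+1) p (by simp)))
  rw [ShortComplex.ShortExact.moduleCat_exact_iff_function_exact] at h
  have h1 : al P Y (p+1) c = 0 ↔ ((cx P Y).homologyι (p+1)).unop c = 0 := by
    have e : al P Y (p+1) c = (iso0 P Y (p+1)).hom.unop (((cx P Y).homologyι (p+1)).unop c) := rfl
    rw [e]
    exact map_eq_zero_iff _ ((ModuleCat.mono_iff_injective (iso0 P Y (p+1)).hom.unop).1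
      inferInstance)
  rw [h1]
  refine (h c).trans ?_
  have inj := (ModuleCat.mono_iff_injective (be P Y (p+1))).1 inferInstance
  have h4 := congrArg Quiver.Hom.unop <| (cx P Y).p_fromOpcycles (p+1) p
  constructor
  · rintro ⟨g, rfl⟩
    exact ⟨g, (congrArg (fun k => k.hom g) h4).symm⟩
  · rintro ⟨g, hg⟩
    exact ⟨g, inj ((congrArg (fun k => k.hom g) h4).trans hg)⟩


open CategoryTheory.Abelian (Ext.mk₀)

abbrev NExt (X Y : ModuleCat.{0} R) (n : ℕ) : Type := Abelian.Ext X Y n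

/-- pullback of an extension class along a morphism -/
def pb {X' X Y : ModuleCat.{0} R} {n : ℕ} (g : X' ⟶ X) (x : NExt X Y n) : NExt X' Y n :=
  (Abelian.Ext.mk₀ g).comp x (zero_add n)

lemma old_dies_iff {X X' Y : ModuleCat.{0} R} (p : ℕ) :
    ∃ r : oldExt X Y (p+1) → NExt X Y (p+1) → Prop,
      (∀ z, ∃ x, r z x) ∧ (∀ x, ∃ z, r z x) ∧
      ∀ z x, r z x → ∀ X' (g : X' ⟶ X),
        (((Ext R (ModuleCat.{0} R) (p+1)).map g.op).app Y z = 0 ↔ pb g x = 0) := by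
  let P := projectiveResolution X
  refine ⟨fun z x => ∃ c, al P Y (p+1) c = z ∧
    P.extMk (be P Y (p+1) c) (p+1+1) rfl ((be_range P Y (p+1) _).1 ⟨c, rfl⟩) = x, ?_, ?_, ?_⟩
  · intro z
    obtain ⟨c, hc⟩ := (ModuleCat.epi_iff_surjective (al P Y (p+1))).1 inferInstance z
    exact ⟨_, c, hc, rfl⟩
  · intro x
    obtain ⟨f, hf, rfl⟩ := P.extMk_surjective x (p+1+1) rfl
    obtain ⟨c, rfl⟩ := (be_range P Y (p+1) _).2 hf
    exact ⟨_, c, rfl, rfl⟩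
  · rintro _ _ ⟨c, rfl, rfl⟩ X' g
    let P' := projectiveResolution X'
    let φ : ProjectiveResolution.Hom P' P g :=
      ⟨ProjectiveResolution.lift g P' P, ProjectiveResolution.lift_commutes_zero g P' P⟩
    have e := congrArg (fun k => k.hom c) (al_nat P P' Y (p+1) φ)
    have e' : ((Ext R (ModuleCat.{0} R) (p+1)).map g.op).app Y (al P Y (p+1) c) =
      al P' Y (p+1) ((HomologicalComplex.opcyclesMap
        (((yF Y).mapHomologicalComplex _).map φ.hom) (p+1)).unop c) := e
    rw [e', al_zero, be_nat]
    unfold pb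
    rw [ProjectiveResolution.mk₀_comp_extMk _ _ _ _ φ,
      ProjectiveResolution.extMk_eq_zero_iff _ _ _ _ _ p rfl]

/-- the transition map -/
def tr (a : Ideal R) {t s : ℕ} (h : t ≤ s) :
    ModuleCat.of R (R ⧸ a ^ s) ⟶ ModuleCat.of R (R ⧸ a ^ t) :=
  ModuleCat.ofHom (Submodule.mapQ _ _ LinearMap.id (Ideal.pow_le_pow_right h))

/-- vanishing of local cohomology -/
def V (a : Ideal R) (i : ℕ) (N : ModuleCat.{0} R) : Prop :=
  ∀ t (x : NExt (ModuleCat.of R (R ⧸ a ^ t)) N i), ∃ s, ∃ h : t ≤ s, pb (tr a h) x = 0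

lemma V_iff (a : Ideal R) (p : ℕ) (N : ModuleCat.{0} R) :
    V a (p+1) N ↔ ¬ Nontrivial ((localCohomology a (p+1)).obj N) := by
  rw [not_nontrivial_iff_subsingleton]
  let F := localCohomology.diagram (localCohomology.idealPowersDiagram a) (p+1)
  let D := isColimitOfPreserves ((evaluation _ (ModuleCat.{0} R)).obj N) (colimit.isColimit F)
  let G := F ⋙ (evaluation _ (ModuleCat.{0} R)).obj N
  have key : Subsingleton ((localCohomology a (p+1)).obj N) ↔
      ∀ t (z : oldExt (ModuleCat.of R (R ⧸ a ^ t)) N (p+1)), ∃ s, ∃ h : t ≤ s,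
        ((Ext R (ModuleCat.{0} R) (p+1)).map (tr a h).op).app N z = 0 := by
    constructor
    · intro hs t z
      have h0 := Concrete.isColimit_exists_of_rep_eq G D (i := op (op t)) (j := op (op t)) z 0
        (hs.elim _ _)
      obtain ⟨k, f, g, hk⟩ := h0
      refine ⟨k.unop.unop, leOfHom f.unop.unop, ?_⟩
      refine Eq.trans ?_ (hk.trans (map_zero (G.map g).hom))
      rfl
    · intro h
      refine subsingleton_of_forall_eq 0 fun y => ?_
      obtain ⟨j, z, hz⟩ := Concrete.isColimit_exists_rep G D y
      obtain ⟨s, hs, h0⟩ := h j.unop.unop z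
      rw [← hz]
      refine (Concrete.isColimit_rep_eq_of_exists G (D := ((evaluation _ (ModuleCat.{0} R)).obj N).mapCocone _) z (0 : G.obj j) ⟨op (op s), (homOfLE hs).op.op, (homOfLE hs).op.op, ?_⟩).trans (map_zero _)
      refine Eq.trans ?_ (map_zero (G.map (homOfLE hs).op.op).hom).symm
      exact h0
  rw [key]
  unfold V
  refine forall_congr' fun t => ?_
  obtain ⟨r, h1, h2, h3⟩ := old_dies_iff (X := ModuleCat.of R (R ⧸ a ^ t))
    (X' := ModuleCat.of R (R ⧸ a ^ t)) (Y := N) p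
  constructor
  · intro h z
    obtain ⟨x, hx⟩ := h1 z
    obtain ⟨s, hs, e⟩ := h x
    exact ⟨s, hs, (h3 z x hx _ _).2 e⟩
  · intro h x
    obtain ⟨z, hx⟩ := h2 x
    obtain ⟨s, hs, e⟩ := h z
    exact ⟨s, hs, (h3 z x hx _ _).1 e⟩

lemma pb_pb {X X' X'' Y : ModuleCat.{0} R} {n : ℕ} (f : X'' ⟶ X') (g : X' ⟶ X)
    (x : NExt X Y n) : pb f (pb g x) = pb (f ≫ g) x := by
  simp [pb]

lemma pb_comp {X X' Y Z : ModuleCat.{0} R} {n m p : ℕ} (g : X' ⟶ X)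
    (x : NExt X Y n) (y : NExt Y Z m) (h : n + m = p) :
    pb g (Abelian.Ext.comp x y h) = Abelian.Ext.comp (pb g x) y h := by
  unfold pb
  rw [Abelian.Ext.comp_assoc _ _ _ (zero_add n) h (by omega)]

lemma pb_zero {X X' Y : ModuleCat.{0} R} {n : ℕ} (g : X' ⟶ X) :
    pb g (0 : NExt X Y n) = 0 := by simp [pb]

lemma tr_tr (a : Ideal R) {t s u : ℕ} (h : t ≤ s) (h' : s ≤ u) :
    tr a h' ≫ tr a h = tr a (h.trans h') := by
  refine ModuleCat.hom_ext (LinearMap.ext fun x => ?_)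
  obtain ⟨x, rfl⟩ := Submodule.Quotient.mk_surjective _ x
  rfl

lemma ses {A B C : Type} [AddCommGroup A] [Module R A] [AddCommGroup B] [Module R B]
    [AddCommGroup C] [Module R C] (f : A →ₗ[R] B) (g : B →ₗ[R] C)
    (hf : Function.Injective f) (hg : Function.Surjective g) (h : Function.Exact f g) :
    ∃ w, (ShortComplex.mk (ModuleCat.ofHom f) (ModuleCat.ofHom g) w).ShortExact := by
  refine ⟨?_, ?_⟩
  · ext x; simp [h.apply_apply_eq_zero]
  · have := (ModuleCat.mono_iff_injective (ModuleCat.ofHom f)).2 hf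
    have := (ModuleCat.epi_iff_surjective (ModuleCat.ofHom g)).2 hg
    refine ShortComplex.ShortExact.mk ?_
    rw [ShortComplex.ShortExact.moduleCat_exact_iff_function_exact]
    exact h


lemma V_mid {S : ShortComplex (ModuleCat.{0} R)} (hS : S.ShortExact) (a : Ideal R) (i : ℕ)
    (h1 : V a i S.X₁) (h3 : V a i S.X₃) : V a i S.X₂ := by
  intro t x
  obtain ⟨s, hs, e⟩ := h3 t (x.comp (Abelian.Ext.mk₀ S.g) (add_zero i))
  rw [pb_comp] at e
  obtain ⟨y, hy⟩ := Abelian.Ext.covariant_sequence_exact₂ _ hS _ e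
  obtain ⟨u, hu, e'⟩ := h1 s y
  refine ⟨u, hs.trans hu, ?_⟩
  rw [← tr_tr a hs hu, ← pb_pb, ← hy, pb_comp, e', Abelian.Ext.zero_comp]

lemma V_right {S : ShortComplex (ModuleCat.{0} R)} (hS : S.ShortExact) (a : Ideal R) (i : ℕ)
    (h2 : V a i S.X₂) (h1 : V a (i+1) S.X₁) : V a i S.X₃ := by
  intro t x
  obtain ⟨s, hs, e⟩ := h1 t (x.comp hS.extClass rfl)
  rw [pb_comp] at e
  obtain ⟨y, hy⟩ := Abelian.Ext.covariant_sequence_exact₃ _ hS _ _ e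
  obtain ⟨u, hu, e'⟩ := h2 s y
  refine ⟨u, hs.trans hu, ?_⟩
  rw [← tr_tr a hs hu, ← pb_pb, ← hy, pb_comp, e', Abelian.Ext.zero_comp]

lemma V_left {S : ShortComplex (ModuleCat.{0} R)} (hS : S.ShortExact) (a : Ideal R) (i : ℕ)
    (h3 : V a i S.X₃) (h2 : V a (i+1) S.X₂) : V a (i+1) S.X₁ := by
  intro t x
  obtain ⟨s, hs, e⟩ := h2 t (x.comp (Abelian.Ext.mk₀ S.f) (add_zero (i+1)))
  rw [pb_comp] at e
  obtain ⟨y, hy⟩ := Abelian.Ext.covariant_sequence_exact₁ _ hS _ e rfl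
  obtain ⟨u, hu, e'⟩ := h3 s y
  refine ⟨u, hs.trans hu, ?_⟩
  rw [← tr_tr a hs hu, ← pb_pb, ← hy, pb_comp, e', Abelian.Ext.zero_comp]


lemma V_inj (a : Ideal R) (i : ℕ) (E : ModuleCat.{0} R) [Injective E] : V a (i+1) E :=
  fun t x => ⟨t, le_rfl, by
    rw [Abelian.Ext.eq_zero_of_injective x]; exact pb_zero _⟩

lemma V_iso (a : Ideal R) (i : ℕ) {N N' : ModuleCat.{0} R} (e : N ≅ N') (h : V a i N) :
    V a i N' := by
  intro t x
  obtain ⟨s, hs, e'⟩ := h t (x.comp (Abelian.Ext.mk₀ e.inv) (add_zero i))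
  refine ⟨s, hs, ?_⟩
  rw [pb_comp] at e'
  have := congrArg (fun z => Abelian.Ext.comp z (Abelian.Ext.mk₀ e.hom) (add_zero i)) e'
  simpa using this

lemma V_subsingleton (a : Ideal R) (i : ℕ) (N : ModuleCat.{0} R) [Subsingleton N] :
    V a i N := by
  intro t x
  refine ⟨t, le_rfl, ?_⟩
  have h0 : 𝟙 N = 0 := by ext; exact Subsingleton.elim _ _
  have : x = 0 := by
    rw [← Abelian.Ext.comp_mk₀_id x, h0]; simp
  rw [this]; exact pb_zero _

/-- torsion submodule -/
def tors (c : Ideal R) (N : Type) [AddCommGroup N] [Module R N] : Submodule R N where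
  carrier := {x | ∃ k, ∀ r ∈ c ^ k, r • x = 0}
  add_mem' := by
    rintro x y ⟨k, hk⟩ ⟨l, hl⟩
    refine ⟨k + l, fun r hr => ?_⟩
    rw [smul_add, hk r (Ideal.pow_le_pow_right (Nat.le_add_right _ _) hr),
      hl r (Ideal.pow_le_pow_right (Nat.le_add_left _ _) hr), add_zero]
  zero_mem' := ⟨0, fun r _ => smul_zero r⟩
  smul_mem' := by
    rintro s x ⟨k, hk⟩
    exact ⟨k, fun r hr => by rw [smul_comm, hk r hr, smul_zero]⟩

def IsTors (c : Ideal R) (N : Type) [AddCommGroup N] [Module R N] : Prop :=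
  ∀ x : N, ∃ k, ∀ r ∈ c ^ k, r • x = 0

lemma isTors_tors (c : Ideal R) (N : Type) [AddCommGroup N] [Module R N] :
    IsTors c (tors c N) := by
  rintro ⟨x, k, hk⟩
  exact ⟨k, fun r hr => Subtype.ext (hk r hr)⟩

lemma IsTors.of_surj {c : Ideal R} {N N' : Type} [AddCommGroup N] [Module R N]
    [AddCommGroup N'] [Module R N'] (h : IsTors c N) (f : N →ₗ[R] N')
    (hf : Function.Surjective f) : IsTors c N' := by
  intro y
  obtain ⟨x, rfl⟩ := hf y
  obtain ⟨k, hk⟩ := h x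
  exact ⟨k, fun r hr => by rw [← map_smul, hk r hr, map_zero]⟩

lemma IsTors.of_inj {c : Ideal R} {N N' : Type} [AddCommGroup N] [Module R N]
    [AddCommGroup N'] [Module R N'] (h : IsTors c N') (f : N →ₗ[R] N')
    (hf : Function.Injective f) : IsTors c N := by
  intro x
  obtain ⟨k, hk⟩ := h (f x)
  exact ⟨k, fun r hr => hf (by rw [map_smul, hk r hr, map_zero])⟩

lemma IsTors.exists_pow {c : Ideal R} {N : Type} [AddCommGroup N] [Module R N]
    [Module.Finite R N] (h : IsTors c N) : ∃ k, ∀ r ∈ c ^ k, ∀ x : N, r • x = 0 := by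
  obtain ⟨S, hS⟩ := (Module.finite_def.1 ‹Module.Finite R N›)
  choose k hk using h
  refine ⟨S.sup k, fun r hr x => ?_⟩
  have : (⊤ : Submodule R N) ≤ LinearMap.ker (LinearMap.lsmul R N r) := by
    rw [← hS, Submodule.span_le]
    intro y hy
    exact hk y r (Ideal.pow_le_pow_right (Finset.le_sup hy) hr)
  exact this (Submodule.mem_top (x := x))

/-- torsion submodules of injective modules are injective -/
lemma tors_baer [IsNoetherianRing R] (c : Ideal R) (E : Type) [AddCommGroup E] [Module R E]
    (hE : Module.Injective R E) : Module.Baer R (tors c E) := by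
  intro I g
  have : Module.Finite R I := Module.Finite.iff_fg.2 (IsNoetherian.noetherian I)
  -- the image of g is killed by a power of c
  obtain ⟨n, hn⟩ : ∃ n, ∀ r ∈ c ^ n, ∀ x : I, r • g x = 0 := by
    have h1 := IsTors.exists_pow (c := c) (N := LinearMap.range g)
      ((isTors_tors c E).of_inj (LinearMap.range g).subtype Subtype.val_injective)
    obtain ⟨k, hk⟩ := h1
    exact ⟨k, fun r hr x => congrArg Subtype.val (hk r hr ⟨g x, x, rfl⟩)⟩
  obtain ⟨k, hk⟩ := Ideal.exists_pow_inf_eq_pow_smul c (M := R) I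
  have hk' := hk (n + k) (Nat.le_add_left _ _)
  have hker : ∀ (x : R) (hx : x ∈ I), x ∈ c ^ (n + k) → g ⟨x, hx⟩ = 0 := by
    intro x hx hxc
    have : x ∈ c ^ n • I := by
      have h2 : x ∈ (c ^ (n + k) • (⊤ : Submodule R R)) ⊓ I := ⟨by simpa using hxc, hx⟩
      rw [hk', Nat.add_sub_cancel] at h2
      exact Submodule.smul_mono le_rfl inf_le_right h2
    have key : ∀ y ∈ c ^ n • I, ∀ hy : y ∈ I, g ⟨y, hy⟩ = 0 := by
      intro y hy
      induction hy using Submodule.smul_induction_on' with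
      | smul r hr m hm =>
        intro hy
        have : (⟨r • m, hy⟩ : I) = r • ⟨m, hm⟩ := rfl
        rw [this, map_smul, hn r hr]
      | add x hx y hy ihx ihy =>
        intro hxy
        have hx' := Submodule.smul_le_right hx
        have hy' := Submodule.smul_le_right hy
        have : (⟨x + y, hxy⟩ : I) = ⟨x, hx'⟩ + ⟨y, hy'⟩ := rfl
        rw [this, map_add, ihx, ihy, add_zero]
    exact key x this hx
  -- the map I / (I ∩ c^(n+k)) → R / c^(n+k)
  let q : I →ₗ[R] R ⧸ c ^ (n + k) := (Submodule.mkQ (c ^ (n + k))).comp I.subtype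
  have hq : LinearMap.ker q ≤ LinearMap.ker ((tors c E).subtype.comp g) := by
    rintro ⟨x, hx⟩ h
    have : x ∈ c ^ (n + k) := by
      have : Submodule.Quotient.mk (p := c ^ (n + k)) x = 0 := h
      rwa [Submodule.Quotient.mk_eq_zero] at this
    simp [hker x hx this]
  let g' := (LinearMap.ker q).liftQ _ hq
  let i' : (I ⧸ LinearMap.ker q) →ₗ[R] R ⧸ c ^ (n + k) := (LinearMap.ker q).liftQ q le_rfl
  have hi' : Function.Injective i' := by
    rw [← LinearMap.ker_eq_bot]; exact Submodule.ker_liftQ_eq_bot' _ _ rfl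
  obtain ⟨φ, hφ⟩ := hE.out i' hi' g'
  let ψ := φ.comp (Submodule.mkQ (c ^ (n + k)))
  refine ⟨ψ.codRestrict (tors c E) (fun x => ⟨n + k, fun r hr => ?_⟩), ?_⟩
  · rw [← map_smul]
    have : Submodule.mkQ (c ^ (n + k)) (r • x) = 0 := by
      exact (Submodule.Quotient.mk_eq_zero _).2 (Ideal.mul_mem_right x _ hr)
    simp only [ψ, LinearMap.comp_apply, this, map_zero]
  · intro x hx
    apply Subtype.ext
    exact hφ (Submodule.Quotient.mk ⟨x, hx⟩)

lemma embed [IsNoetherianRing R] (c : Ideal R) (N : ModuleCat.{0} R) (hN : IsTors c N) :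
    ∃ (E Q : ModuleCat.{0} R) (f : N ⟶ E) (g : E ⟶ Q) (w : f ≫ g = 0),
      (ShortComplex.mk f g w).ShortExact ∧ Injective E ∧ IsTors c E ∧ IsTors c Q := by
  let E0 := Injective.under N
  have hE0 : Module.Injective R E0 := by
    rw [Module.injective_iff_injective_object]
    exact inferInstanceAs (Injective (Injective.under N))
  let ι : N →ₗ[R] E0 := (Injective.ι N).hom
  have hι : Function.Injective ι := (ModuleCat.mono_iff_injective (Injective.ι N)).1 inferInstance
  let f : N →ₗ[R] tors c E0 := ι.codRestrict _ (fun x => by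
    obtain ⟨k, hk⟩ := hN x
    exact ⟨k, fun r hr => by rw [← map_smul, hk r hr, map_zero]⟩)
  have hf : Function.Injective f := fun x y h => hι (congrArg Subtype.val h)
  obtain ⟨w, hw⟩ := ses f (LinearMap.range f).mkQ hf (Submodule.mkQ_surjective _)
    (LinearMap.exact_map_mkQ_range f)
  have hinj : Module.Injective R (tors c E0) := (tors_baer c E0 hE0).injective
  refine ⟨ModuleCat.of R (tors c E0), ModuleCat.of R (_ ⧸ LinearMap.range f), _, _, w, hw,
    ?_, isTors_tors c E0, (isTors_tors c E0).of_surj _ (Submodule.mkQ_surjective _)⟩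
  rwa [Module.injective_iff_injective_object] at hinj

lemma F6 [IsNoetherianRing R] (a b : Ideal R) (j : ℕ) :
    ∀ (T : ModuleCat.{0} R), IsTors b T → V a (j+1) T → V (a ⊔ b) (j+1) T := by
  induction j with
  | succ j ih =>
    intro T hT h
    obtain ⟨E, Q, f, g, w, hS, hE, hE', hQ⟩ := embed b T hT
    exact V_left hS _ _ (ih Q hQ (V_right hS _ _ (V_inj _ _ E) h)) (V_inj _ _ E)
  | zero =>
    intro T hT h
    obtain ⟨E, Q, f, g, w, hS, hE, hE', hQ⟩ := embed b T hT
    intro t x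
    obtain ⟨x₃, hx₃⟩ := Abelian.Ext.covariant_sequence_exact₁ _ hS x
      (Abelian.Ext.eq_zero_of_injective _) (zero_add 1)
    obtain ⟨u, rfl⟩ := (Abelian.Ext.mk₀_bijective _ _).2 x₃
    let π : ModuleCat.of R (R ⧸ a ^ t) ⟶ ModuleCat.of R (R ⧸ (a ⊔ b) ^ t) :=
      ModuleCat.ofHom (Submodule.mapQ _ _ LinearMap.id (Ideal.pow_right_mono le_sup_left t))
    obtain ⟨s, hs, e⟩ := h t (pb π x)
    rw [pb_pb, ← hx₃, pb_comp] at e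
    obtain ⟨x₂, hx₂⟩ := Abelian.Ext.covariant_sequence_exact₃ _ hS _ _ e
    obtain ⟨v, rfl⟩ := (Abelian.Ext.mk₀_bijective _ _).2 x₂
    have hv : v ≫ g = (tr a hs ≫ π) ≫ u := by
      apply (Abelian.Ext.mk₀_bijective _ _).1
      simpa [pb] using hx₂
    let e1 : E := v.hom (Submodule.Quotient.mk (1 : R))
    have hge : g.hom e1 = u.hom (Submodule.Quotient.mk (1 : R)) :=
      congrArg (fun k => k.hom (Submodule.Quotient.mk (1 : R))) hv
    have ha : ∀ r ∈ a ^ s, r • e1 = 0 := by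
      intro r hr
      have : r • (Submodule.Quotient.mk (1 : R) : R ⧸ a ^ s) = 0 := by
        rw [← Submodule.Quotient.mk_smul, Submodule.Quotient.mk_eq_zero]
        simpa using hr
      calc r • e1 = v.hom (r • (Submodule.Quotient.mk (1 : R) : R ⧸ a ^ s)) :=
            (map_smul v.hom r _).symm
        _ = 0 := by rw [this]; exact map_zero v.hom
    obtain ⟨k, hk⟩ := hE' e1
    have hab : (a ⊔ b) ^ (s + k) ≤ LinearMap.ker (LinearMap.toSpanSingleton R E e1) := by
      refine (Ideal.sup_pow_add_le_pow_sup_pow).trans (sup_le ?_ ?_)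
      · exact fun r hr => ha r hr
      · exact fun r hr => hk r hr
    let w' : ModuleCat.of R (R ⧸ (a ⊔ b) ^ (s + k)) ⟶ E :=
      ModuleCat.ofHom (Submodule.liftQ _ _ hab)
    have hts : t ≤ s + k := by omega
    have hw' : w' ≫ g = tr (a ⊔ b) hts ≫ u := by
      refine ModuleCat.hom_ext (LinearMap.ext fun y => ?_)
      obtain ⟨y, rfl⟩ := Submodule.Quotient.mk_surjective _ y
      have h1 : g.hom (y • e1) = u.hom (y • (Submodule.Quotient.mk (1 : R))) := by
        rw [map_smul, hge]; exact (map_smul u.hom _ _).symm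
      have h2 : (y • (Submodule.Quotient.mk (1 : R)) : R ⧸ (a ⊔ b) ^ t)
          = Submodule.Quotient.mk y := by
        rw [← Submodule.Quotient.mk_smul]; simp
      rw [h2] at h1
      exact h1
    refine ⟨s + k, hts, ?_⟩
    rw [← hx₃, pb_comp]
    have : pb (tr (a ⊔ b) hts) (Abelian.Ext.mk₀ u) =
        (Abelian.Ext.mk₀ w').comp (Abelian.Ext.mk₀ g) (zero_add 0) := by
      simp [pb, hw']
    rw [this, Abelian.Ext.comp_assoc_of_second_deg_zero]
    have := hS.comp_extClass
    dsimp only at this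
    rw [this, Abelian.Ext.comp_zero]

lemma V_bot (j : ℕ) (T : ModuleCat.{0} R) : V ⊥ (j+1) T := by
  intro t x
  refine ⟨t + 1, Nat.le_succ t, ?_⟩
  have : Projective (ModuleCat.of R (R ⧸ (⊥ : Ideal R) ^ (t + 1))) := by
    rw [← IsProjective.iff_projective]
    have e : (R ⧸ (⊥ : Ideal R) ^ (t + 1)) ≃ₗ[R] R :=
      Submodule.quotEquivOfEqBot _ (by
        rw [pow_succ]; exact Ideal.mul_bot _)
    exact Module.Projective.of_equiv e.symm
  exact Abelian.Ext.eq_zero_of_projective _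

lemma tors_acyclic [IsNoetherianRing R] (b : Ideal R) (j : ℕ) (T : ModuleCat.{0} R)
    (hT : IsTors b T) : V b (j+1) T := by
  have := F6 ⊥ b j T hT (V_bot j T)
  rwa [bot_sup_eq] at this

lemma ext_zero_of_subsingleton {A L : ModuleCat.{0} R} [Subsingleton A] {j : ℕ}
    (x : NExt A L j) : x = 0 := by
  have h0 : 𝟙 A = 0 := by ext; exact Subsingleton.elim _ _
  rw [← Abelian.Ext.mk₀_id_comp x, h0]; simp

lemma F5_step [IsNoetherianRing R] (b : Ideal R) (L : ModuleCat.{0} R) (j : ℕ)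
    (hV : V b j L)
    (inj : ∀ (A' A : Type) [AddCommGroup A'] [Module R A'] [AddCommGroup A] [Module R A]
      [Module.Finite R A'] (_ : ∃ t, ∀ r ∈ b ^ t, ∀ y : A', r • y = 0)
      (p : A' →ₗ[R] A) (_ : Function.Surjective p) (x : NExt (ModuleCat.of R A) L j),
      pb (ModuleCat.ofHom p) x = 0 → x = 0)
    (A : Type) [AddCommGroup A] [Module R A] [Module.Finite R A] :
    (∃ t, ∀ r ∈ b ^ t, ∀ y : A, r • y = 0) → ∀ x : NExt (ModuleCat.of R A) L j, x = 0 := by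
  have hq : ∀ t, ∀ x : NExt (ModuleCat.of R (R ⧸ b ^ t)) L j, x = 0 := by
    intro t x
    obtain ⟨s, hs, e⟩ := hV t x
    refine inj (R ⧸ b ^ s) (R ⧸ b ^ t) ⟨s, fun r hr y => ?_⟩ _ ?_ x e
    · obtain ⟨y, rfl⟩ := Submodule.Quotient.mk_surjective _ y
      exact (Submodule.Quotient.mk_eq_zero _).2 (Ideal.mul_mem_right y _ hr)
    · intro y
      obtain ⟨y, rfl⟩ := Submodule.Quotient.mk_surjective _ y
      exact ⟨Submodule.Quotient.mk y, rfl⟩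
  refine IsNoetherianRing.induction_on_isQuotientEquivQuotientPrime R
    (motive := fun N _ _ _ => (∃ t, ∀ r ∈ b ^ t, ∀ y : N, r • y = 0) →
      ∀ x : NExt (ModuleCat.of R N) L j, x = 0) ‹_› ?_ ?_ ?_
  · intro N _ _ _ _ _ x
    exact ext_zero_of_subsingleton x
  · rintro N _ _ _ p e ⟨t, ht⟩ x
    let n0 : N := e.symm (Submodule.Quotient.mk 1)
    let f : (R ⧸ b ^ t) →ₗ[R] N := Submodule.liftQ _ (LinearMap.toSpanSingleton R N n0)
      (fun r hr => ht r hr n0)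
    refine inj (R ⧸ b ^ t) N ⟨t, fun r hr y => ?_⟩ f ?_ x (hq t _)
    · obtain ⟨y, rfl⟩ := Submodule.Quotient.mk_surjective _ y
      exact (Submodule.Quotient.mk_eq_zero _).2 (Ideal.mul_mem_right y _ hr)
    · intro y
      obtain ⟨z, hz⟩ := Submodule.Quotient.mk_surjective _ (e y)
      refine ⟨Submodule.Quotient.mk z, ?_⟩
      apply e.injective
      rw [← hz]
      change e (z • n0) = _
      rw [map_smul, LinearEquiv.apply_symm_apply, ← Submodule.Quotient.mk_smul]
      simp
  · rintro N₁ _ _ _ N₂ _ _ _ N₃ _ _ _ f g hf hg hfg h1 h3 ⟨t, ht⟩ x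
    obtain ⟨w, hS⟩ := ses f g hf hg hfg
    have k1 := h1 ⟨t, fun r hr y => hf (by rw [map_smul, ht r hr, map_zero])⟩
    have k3 := h3 ⟨t, fun r hr y => by
      obtain ⟨y, rfl⟩ := hg y
      rw [← map_smul, ht r hr, map_zero]⟩
    obtain ⟨y, hy⟩ := Abelian.Ext.contravariant_sequence_exact₂ hS L x (k1 _)
    rw [← hy]
    have : y = 0 := k3 y
    rw [this, Abelian.Ext.comp_zero]

lemma F5 [IsNoetherianRing R] (b : Ideal R) (L : ModuleCat.{0} R) (hV : ∀ j, V b j L)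
    (j : ℕ) : ∀ (A : Type) [AddCommGroup A] [Module R A] [Module.Finite R A],
    (∃ t, ∀ r ∈ b ^ t, ∀ y : A, r • y = 0) → ∀ x : NExt (ModuleCat.of R A) L j, x = 0 := by
  induction j with
  | zero =>
    intro A _ _ _
    refine F5_step b L 0 (hV 0) ?_ A
    intro A' A _ _ _ _ _ _ p hp x hx
    have : Epi (ModuleCat.ofHom p) := (ModuleCat.epi_iff_surjective _).2 hp
    exact Abelian.Ext.precomp_mk₀_injective_of_epi L (ModuleCat.ofHom p)
      (hx.trans (pb_zero (ModuleCat.ofHom p)).symm)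
  | succ j ih =>
    intro A _ _ _
    refine F5_step b L (j+1) (hV (j+1)) ?_ A
    intro A' A _ _ _ _ _ ht p hp x hx
    obtain ⟨t, ht⟩ := ht
    obtain ⟨w, hS⟩ := ses (LinearMap.ker p).subtype p Subtype.val_injective hp
      (LinearMap.exact_subtype_ker_map p)
    have : Module.Finite R (LinearMap.ker p) :=
      Module.Finite.iff_fg.2 (IsNoetherian.noetherian _)
    obtain ⟨y, hy⟩ := Abelian.Ext.contravariant_sequence_exact₃ hS L x hx (add_comm 1 j)
    have : y = 0 := ih (LinearMap.ker p) ⟨t, fun r hr z => Subtype.ext (ht r hr z)⟩ y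
    rw [← hy, this, Abelian.Ext.comp_zero]

lemma F5' [IsNoetherianRing R] (a b : Ideal R) (L : ModuleCat.{0} R) (hV : ∀ j, V b j L)
    (j : ℕ) : V (a ⊔ b) j L := by
  intro t x
  refine ⟨t, le_rfl, ?_⟩
  have : x = 0 := F5 b L hV j (R ⧸ (a ⊔ b) ^ t) ⟨t, fun r hr y => by
    obtain ⟨y, rfl⟩ := Submodule.Quotient.mk_surjective _ y
    exact (Submodule.Quotient.mk_eq_zero _).2
      (Ideal.mul_mem_right y _ (Ideal.pow_right_mono le_sup_right t hr))⟩ x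
  rw [this]; exact pb_zero _

lemma F4 [IsNoetherianRing R] (a b c : Ideal R) (da : ℕ)
    (ha : ∀ N : ModuleCat.{0} R, IsTors c N → ∀ j, da < j → V a j N) (e : ℕ) :
    ∀ N : ModuleCat.{0} R, IsTors c N → (∀ j, e < j → V b j N) →
      ∀ i, da + e < i → V (a ⊔ b) i N := by
  induction e with
  | succ e ih =>
    intro N hN hb i hi
    obtain ⟨E, Q, f, g, w, hS, hE, hE', hQ⟩ := embed c N hN
    obtain ⟨i, rfl⟩ : ∃ k, i = k + 1 := ⟨i - 1, by omega⟩
    refine V_left hS _ _ (ih Q hQ (fun j hj => ?_) i (by omega)) (V_inj _ _ E)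
    obtain ⟨j, rfl⟩ : ∃ k, j = k + 1 := ⟨j - 1, by omega⟩
    exact V_right hS _ _ (V_inj _ _ E) (hb _ (by omega))
  | zero =>
    intro N hN hb i hi
    obtain ⟨w, hS⟩ := ses (tors b N).subtype (tors b N).mkQ Subtype.val_injective
      (Submodule.mkQ_surjective _) (LinearMap.exact_subtype_mkQ _)
    have hT : IsTors b (tors b N) := isTors_tors b N
    have hTc : IsTors c (tors b N) := hN.of_inj (tors b N).subtype Subtype.val_injective
    obtain ⟨i, rfl⟩ : ∃ k, i = k + 1 := ⟨i - 1, by omega⟩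
    have h1 : V (a ⊔ b) (i+1) (ModuleCat.of R (tors b N)) :=
      F6 a b i _ hT (ha (ModuleCat.of R (tors b N)) hTc _ (by omega))
    have h3 : V (a ⊔ b) (i+1) (ModuleCat.of R (N ⧸ tors b N)) := by
      refine F5' a b _ (fun j => ?_) _
      cases j with
      | succ j =>
        exact V_right hS _ _ (hb _ (by omega)) (tors_acyclic b _ _ hT)
      | zero =>
        intro t x
        refine ⟨t, le_rfl, ?_⟩
        obtain ⟨u, rfl⟩ := (Abelian.Ext.mk₀_bijective _ _).2 x
        suffices hu : u = 0 by rw [hu, Abelian.Ext.mk₀_zero]; exact pb_zero _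
        obtain ⟨n, hn⟩ := Submodule.Quotient.mk_surjective _
          (u.hom (Submodule.Quotient.mk (1 : R)))
        have hnt : ∀ r ∈ b ^ t, r • n ∈ tors b N := by
          intro r hr
          have h0 : r • (Submodule.Quotient.mk (1 : R) : R ⧸ b ^ t) = 0 := by
            rw [← Submodule.Quotient.mk_smul, Submodule.Quotient.mk_eq_zero]
            simpa using hr
          rw [← Submodule.Quotient.mk_eq_zero, Submodule.Quotient.mk_smul, hn]
          calc r • u.hom (Submodule.Quotient.mk (1 : R))
            _ = u.hom (r • (Submodule.Quotient.mk (1 : R) : R ⧸ b ^ t)) :=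
              (map_smul u.hom r _).symm
            _ = 0 := by rw [h0]; exact map_zero u.hom
        let P : Submodule R N := Submodule.map (LinearMap.toSpanSingleton R N n) (b ^ t)
        have hP : Module.Finite R P :=
          Module.Finite.iff_fg.2 ((IsNoetherian.noetherian (b ^ t)).map _)
        have hPt : IsTors b P := by
          rintro ⟨_, r, hr, rfl⟩
          obtain ⟨k, hk⟩ := hnt r hr
          exact ⟨k, fun s hs => Subtype.ext (hk s hs)⟩
        obtain ⟨k, hk⟩ := hPt.exists_pow
        have hnT : n ∈ tors b N := by
          refine ⟨k + t, fun r hr => ?_⟩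
          rw [pow_add] at hr
          refine Submodule.mul_induction_on hr ?_ ?_
          · intro x hx y hy
            rw [mul_smul]
            exact congrArg Subtype.val (hk x hx ⟨y • n, y, hy, rfl⟩)
          · intro x y hx hy
            rw [add_smul, hx, hy, add_zero]
        rw [(Submodule.Quotient.mk_eq_zero _).2 hnT] at hn
        refine ModuleCat.hom_ext (LinearMap.ext fun y => ?_)
        obtain ⟨y, rfl⟩ := Submodule.Quotient.mk_surjective _ y
        have h2 : (Submodule.Quotient.mk y : R ⧸ b ^ t) =
            y • (Submodule.Quotient.mk (1 : R)) := by
          rw [← Submodule.Quotient.mk_smul]; simp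
        rw [h2]
        refine (map_smul u.hom y _).trans ?_
        rw [← hn]
        exact smul_zero y
    exact V_mid hS _ _ h1 h3

lemma isTors_bot (N : Type) [AddCommGroup N] [Module R N] : IsTors (⊥ : Ideal R) N := by
  intro x
  refine ⟨1, fun r hr => ?_⟩
  rw [pow_one] at hr
  rw [(Submodule.mem_bot R).1 hr, zero_smul]

lemma V_of_unit (x : R) (j : ℕ) (L : ModuleCat.{0} R)
    (hx : Function.Bijective (fun y : L => x • y)) : V (Ideal.span {x}) j L := by
  intro t z
  refine ⟨t, le_rfl, ?_⟩
  have hb : ∀ t : ℕ, Function.Bijective (fun y : L => x ^ t • y) := by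
    intro t
    induction t with
    | zero =>
      have : (fun y : L => x ^ 0 • y) = id := by funext y; simp
      rw [this]; exact Function.bijective_id
    | succ t ih =>
      have : (fun y : L => x ^ (t+1) • y) = (fun y : L => x ^ t • y) ∘ (fun y : L => x • y) := by
        funext y; simp [pow_succ, mul_smul]
      rw [this]; exact ih.comp hx
  have h1 : (x ^ t) • z = 0 := by
    rw [← Abelian.Ext.mk₀_id_comp z, ← Abelian.Ext.smul_comp, ← Abelian.Ext.mk₀_smul]
    have : x ^ t • 𝟙 (ModuleCat.of R (R ⧸ Ideal.span {x} ^ t)) = 0 := by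
      refine ModuleCat.hom_ext (LinearMap.ext fun y => ?_)
      obtain ⟨y, rfl⟩ := Submodule.Quotient.mk_surjective _ y
      exact (Submodule.Quotient.mk_eq_zero _).2 (Ideal.mul_mem_right y _
        (Ideal.pow_mem_pow (Ideal.mem_span_singleton_self x) t))
    rw [this]; simp
  rw [Abelian.Ext.smul_eq_comp_mk₀] at h1
  have hiso : IsIso (x ^ t • 𝟙 L) := by
    have := (ModuleCat.mono_iff_injective (x ^ t • 𝟙 L)).2 (hb t).1
    have := (ModuleCat.epi_iff_surjective (x ^ t • 𝟙 L)).2 (hb t).2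
    exact isIso_of_mono_of_epi _
  have : z = 0 := by
    have := congrArg (fun y => Abelian.Ext.comp y (Abelian.Ext.mk₀ (inv (x ^ t • 𝟙 L)))
      (add_zero j)) h1
    simpa using this
  rw [this]; exact pb_zero _

lemma F1_principal [IsNoetherianRing R] (x : R) (N : ModuleCat.{0} R) (i : ℕ) (hi : 1 < i) :
    V (Ideal.span {x}) i N := by
  obtain ⟨i, rfl⟩ : ∃ k, i = k + 2 := ⟨i - 2, by omega⟩
  let L := LocalizedModule (Submonoid.powers x) N
  let f : N →ₗ[R] L := LocalizedModule.mkLinearMap (Submonoid.powers x) N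
  have hLx : Function.Bijective (fun y : L => x • y) := by
    have := IsLocalizedModule.map_units f (⟨x, 1, pow_one x⟩ : Submonoid.powers x)
    exact (Module.End.isUnit_iff _).1 this
  have hL : ∀ j, V (Ideal.span {x}) j (ModuleCat.of R L) := fun j => V_of_unit x j _ hLx
  have tors_of : ∀ (K : Type) [AddCommGroup K] [Module R K],
      (∀ y : K, ∃ k, x ^ k • y = 0) → IsTors (Ideal.span {x}) K := by
    intro K _ _ h y
    obtain ⟨k, hk⟩ := h y
    refine ⟨k, fun r hr => ?_⟩
    rw [Ideal.span_singleton_pow, Ideal.mem_span_singleton'] at hr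
    obtain ⟨s, rfl⟩ := hr
    rw [mul_smul, hk, smul_zero]
  have hker : IsTors (Ideal.span {x}) (LinearMap.ker f) := by
    refine tors_of _ ?_
    rintro ⟨y, hy⟩
    obtain ⟨⟨_, k, rfl⟩, h⟩ := (IsLocalizedModule.eq_zero_iff (Submonoid.powers x) f).1 hy
    exact ⟨k, Subtype.ext h⟩
  have hcok : IsTors (Ideal.span {x}) (L ⧸ LinearMap.range f) := by
    refine tors_of _ ?_
    intro y
    obtain ⟨y, rfl⟩ := Submodule.Quotient.mk_surjective _ y
    obtain ⟨⟨n, ⟨_, k, rfl⟩⟩, h⟩ := IsLocalizedModule.surj (Submonoid.powers x) f y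
    refine ⟨k, ?_⟩
    rw [← Submodule.Quotient.mk_smul, Submodule.Quotient.mk_eq_zero]
    exact ⟨n, h.symm⟩
  obtain ⟨w2, hS2⟩ := ses (LinearMap.range f).subtype (LinearMap.range f).mkQ
    Subtype.val_injective (Submodule.mkQ_surjective _) (LinearMap.exact_subtype_mkQ _)
  have hr : V (Ideal.span {x}) (i+2) (ModuleCat.of R (LinearMap.range f)) :=
    V_left hS2 _ (i+1) (tors_acyclic _ _ _ hcok) (hL _)
  obtain ⟨w1, hS1⟩ := ses (LinearMap.ker f).subtype f.rangeRestrict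
    Subtype.val_injective f.surjective_rangeRestrict (by
      intro y
      constructor
      · intro h
        exact ⟨⟨y, by simpa using congrArg Subtype.val h⟩, rfl⟩
      · rintro ⟨⟨y, h⟩, rfl⟩
        exact Subtype.ext h)
  exact V_mid hS1 _ _ (tors_acyclic _ _ _ hker) hr

lemma F1 [IsNoetherianRing R] (a : Ideal R) :
    ∃ n, ∀ (N : ModuleCat.{0} R) (i : ℕ), n < i → V a i N := by
  refine Submodule.fg_induction
    (motive := fun a _ => ∃ n, ∀ (N : ModuleCat.{0} R) (i : ℕ), n < i → V a i N) ?_ ?_ a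
    (IsNoetherian.noetherian a)
  · intro x
    exact ⟨1, fun N i hi => F1_principal x N i hi⟩
  · rintro a b ha hb ⟨n, hn⟩ ⟨m, hm⟩
    exact ⟨n + m, fun N i hi => F4 a b ⊥ n (fun N _ j hj => hn N j hj) m N (isTors_bot N)
      (fun j hj => hm N j hj) i hi⟩

/-- classes come from finitely generated submodules -/
lemma F3_aux [IsNoetherianRing R] (N : ModuleCat.{0} R) (i : ℕ) :
    ∀ (A : Type) [AddCommGroup A] [Module R A] [Module.Finite R A]
      (x : NExt (ModuleCat.of R A) N i), ∃ N0 : Submodule R N, N0.FG ∧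
        ∃ y : NExt (ModuleCat.of R A) (ModuleCat.of R N0) i,
          Abelian.Ext.comp y (Abelian.Ext.mk₀ (ModuleCat.ofHom N0.subtype)) (add_zero i) = x := by
  induction i with
  | zero =>
    intro A _ _ _ x
    obtain ⟨u, rfl⟩ := (Abelian.Ext.mk₀_bijective _ _).2 x
    refine ⟨LinearMap.range u.hom, ?_, Abelian.Ext.mk₀ (ModuleCat.ofHom u.hom.rangeRestrict), ?_⟩
    · rw [LinearMap.range_eq_map]
      exact (Module.finite_def.1 ‹Module.Finite R A›).map _
    · rw [Abelian.Ext.mk₀_comp_mk₀]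
      rfl
  | succ i ih =>
    intro A _ _ _ x
    obtain ⟨n, p, hp⟩ := Module.Finite.exists_fin' R A
    obtain ⟨w, hS⟩ := ses (LinearMap.ker p).subtype p Subtype.val_injective hp
      (LinearMap.exact_subtype_ker_map p)
    have : Module.Finite R (LinearMap.ker p) :=
      Module.Finite.iff_fg.2 (IsNoetherian.noetherian _)
    have : Projective (ModuleCat.of R (Fin n → R)) := by
      rw [← IsProjective.iff_projective]; infer_instance
    obtain ⟨y, hy⟩ := Abelian.Ext.contravariant_sequence_exact₃ hS N x
      (Abelian.Ext.eq_zero_of_projective (P := ModuleCat.of R (Fin n → R)) _) (add_comm 1 i)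
    obtain ⟨N0, h0, z, hz⟩ := ih (LinearMap.ker p) y
    refine ⟨N0, h0, hS.extClass.comp z (add_comm 1 i), ?_⟩
    rw [Abelian.Ext.comp_assoc_of_third_deg_zero, ← hy]
    exact congrArg (fun k => hS.extClass.comp k (add_comm 1 i)) hz

lemma F3 [IsNoetherianRing R] (a : Ideal R) (N : ModuleCat.{0} R) (i : ℕ)
    (h : ∀ N0 : Submodule R N, N0.FG → V a i (ModuleCat.of R N0)) : V a i N := by
  intro t x
  obtain ⟨N0, h0, y, rfl⟩ := F3_aux N i _ x
  obtain ⟨s, hs, e⟩ := h N0 h0 t y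
  refine ⟨s, hs, ?_⟩
  rw [pb_comp, e, Abelian.Ext.zero_comp]

lemma devis [IsNoetherianRing R] (a I : Ideal R) (i : ℕ)
    (h : ∀ q : Ideal R, q.IsPrime → I ≤ q → V a i (ModuleCat.of R (R ⧸ q)))
    (N : Type) [AddCommGroup N] [Module R N] [Module.Finite R N] :
    (∃ k, ∀ r ∈ I ^ k, ∀ x : N, r • x = 0) → V a i (ModuleCat.of R N) := by
  refine IsNoetherianRing.induction_on_isQuotientEquivQuotientPrime R
    (motive := fun N _ _ _ => (∃ t, ∀ r ∈ I ^ t, ∀ y : N, r • y = 0) →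
      V a i (ModuleCat.of R N)) ‹_› ?_ ?_ ?_
  · intro N _ _ _ _ _
    exact V_subsingleton a i _
  · rintro N _ _ _ p e ⟨k, hk⟩
    have hp : I ≤ p.1 := by
      refine p.2.le_of_pow_le (n := k) (fun r hr => ?_)
      have h1 := hk r hr (e.symm (Submodule.Quotient.mk 1))
      rw [← map_smul, LinearEquiv.map_eq_zero_iff, ← Submodule.Quotient.mk_smul,
        Submodule.Quotient.mk_eq_zero] at h1
      simpa using h1
    exact V_iso a i e.symm.toModuleIso (h p.1 p.2 hp)
  · rintro N₁ _ _ _ N₂ _ _ _ N₃ _ _ _ f g hf hg hfg h1 h3 ⟨t, ht⟩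
    obtain ⟨w, hS⟩ := ses f g hf hg hfg
    have k1 := h1 ⟨t, fun r hr y => hf (by rw [map_smul, ht r hr, map_zero])⟩
    have k3 := h3 ⟨t, fun r hr y => by
      obtain ⟨y, rfl⟩ := hg y
      rw [← map_smul, ht r hr, map_zero]⟩
    exact V_mid hS _ _ k1 k3

lemma F7_prime [IsNoetherianRing R] (a : Ideal R) (M : ModuleCat.{0} R) [Module.Finite R M]
    (i : ℕ) (hM : V a i M)
    (hi : ∀ N : ModuleCat.{0} R, IsTors (Module.annihilator R M) N → V a (i+1) N)
    (p : Ideal R) : p.IsPrime → Module.annihilator R M ≤ p → V a i (ModuleCat.of R (R ⧸ p)) := by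
  induction p using WellFoundedGT.induction with
  | ind p ih =>
  intro hp hc
  obtain ⟨g, hg⟩ : ∃ g : M →ₗ[R] R ⧸ p, g ≠ 0 := by
    by_contra! hall
    have hss : Subsingleton (M →ₗ[R] R ⧸ p) := subsingleton_of_forall_eq 0 hall
    obtain ⟨r, hr, hreg⟩ := IsSMulRegular.subsingleton_linearMap_iff.1 hss
    have h1 : (Submodule.Quotient.mk (1 : R) : R ⧸ p) = 0 := by
      apply hreg
      change r • _ = r • _
      rw [smul_zero, ← Submodule.Quotient.mk_smul, Submodule.Quotient.mk_eq_zero]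
      simpa using hc hr
    rw [Submodule.Quotient.mk_eq_zero] at h1
    exact hp.ne_top ((Ideal.eq_top_iff_one p).2 h1)
  obtain ⟨m, hm⟩ : ∃ m, g m ≠ 0 := by
    by_contra! hall
    exact hg (LinearMap.ext hall)
  obtain ⟨r, hr⟩ := Submodule.Quotient.mk_surjective _ (g m)
  have hrp : r ∉ p := by
    intro h
    rw [← Submodule.Quotient.mk_eq_zero, hr] at h
    exact hm h
  -- the image
  have hJ : V a i (ModuleCat.of R (LinearMap.range g)) := by
    obtain ⟨w1, hS1⟩ := ses (LinearMap.ker g).subtype g.rangeRestrict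
      Subtype.val_injective g.surjective_rangeRestrict (by
        intro y
        constructor
        · intro h
          exact ⟨⟨y, congrArg Subtype.val h⟩, rfl⟩
        · rintro ⟨⟨y, h⟩, rfl⟩
          exact Subtype.ext h)
    refine V_right hS1 _ _ hM (hi _ ?_)
    intro x
    refine ⟨1, fun s hs => ?_⟩
    rw [pow_one] at hs
    exact Subtype.ext (Module.mem_annihilator.1 hs x.1)
  have hC : V a i (ModuleCat.of R ((R ⧸ p) ⧸ LinearMap.range g)) := by
    refine devis a (p ⊔ Ideal.span {r}) i ?_ _ ⟨1, ?_⟩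
    · intro q hq hle
      refine ih q ?_ hq ?_
      · refine lt_of_le_of_ne (le_sup_left.trans hle) ?_
        rintro rfl
        exact hrp (hle (Ideal.mem_sup_right (Ideal.mem_span_singleton_self r)))
      · exact hc.trans (le_sup_left.trans hle)
    · intro s hs x
      rw [pow_one] at hs
      obtain ⟨x, rfl⟩ := Submodule.Quotient.mk_surjective _ x
      obtain ⟨x, rfl⟩ := Submodule.Quotient.mk_surjective _ x
      rw [← Submodule.Quotient.mk_smul, Submodule.Quotient.mk_eq_zero,
        ← Submodule.Quotient.mk_smul]
      obtain ⟨u, hu, v, hv, rfl⟩ := Submodule.mem_sup.1 hs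
      obtain ⟨z, rfl⟩ := Ideal.mem_span_singleton'.1 hv
      have : (Submodule.Quotient.mk ((u + z * r) • x) : R ⧸ p) = (z * x) • g m := by
        rw [← hr, ← Submodule.Quotient.mk_smul, Submodule.Quotient.eq]
        have : (u + z * r) • x - (z * x) • r = u * x := by
          simp only [smul_eq_mul]; ring
        rw [this]
        exact Ideal.mul_mem_right _ _ hu
      rw [this]
      exact Submodule.smul_mem _ _ ⟨m, rfl⟩
  obtain ⟨w2, hS2⟩ := ses (LinearMap.range g).subtype (LinearMap.range g).mkQ
    Subtype.val_injective (Submodule.mkQ_surjective _) (LinearMap.exact_subtype_mkQ _)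
  exact V_mid hS2 _ _ hJ hC

lemma F7 [IsNoetherianRing R] (a : Ideal R) (M : ModuleCat.{0} R) [Module.Finite R M]
    (d : ℕ) (hM : ∀ j, d < j → V a j M) :
    ∀ N : ModuleCat.{0} R, IsTors (Module.annihilator R M) N → ∀ j, d < j → V a j N := by
  obtain ⟨n, hn⟩ := F1 a
  have key : ∀ k j, d < j → n < j + k →
      ∀ N : ModuleCat.{0} R, IsTors (Module.annihilator R M) N → V a j N := by
    intro k
    induction k with
    | zero => intro j _ hj N _; exact hn N j hj
    | succ k ih =>
      intro j hd hj N hN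
      refine F3 a N j (fun N0 h0 => ?_)
      have : Module.Finite R N0 := Module.Finite.iff_fg.2 h0
      refine devis a (Module.annihilator R M) j ?_ N0
        (IsTors.exists_pow (hN.of_inj N0.subtype Subtype.val_injective))
      exact F7_prime a M j (hM j hd) (fun N hN => ih (j+1) (by omega) (by omega) N hN)
  exact fun N hN j hj => key (n+1) j hj (by omega) N hN

lemma V_of_cohDim [IsNoetherianRing R] (a : Ideal R) (M : ModuleCat.{0} R) (j : ℕ)
    (hj : cohDim a M < j) : V a j M := by
  obtain ⟨p, rfl⟩ : ∃ k, j = k + 1 := ⟨j - 1, by omega⟩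
  rw [V_iff]
  intro h
  obtain ⟨n, hn⟩ := F1 a
  have hb : BddAbove {i : ℕ | Nontrivial ((localCohomology a i).obj M)} := by
    refine ⟨n, fun i hi => ?_⟩
    by_contra! hlt
    obtain ⟨k, rfl⟩ : ∃ k, i = k + 1 := ⟨i - 1, by omega⟩
    exact (V_iff a k M).1 (hn M _ hlt) hi
  have := le_csSup hb h
  unfold cohDim at hj
  omega

end

end LC

/-- Let `R` be a commutative noetherian ring, `a, b` ideals of `R` and `M` a
finitely generated `R`-module.  Then `cd(a + b, M) ≤ cd(a, M) + cd(b, M)`. -/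
theorem statement1 {R : Type} [CommRing R] [IsNoetherianRing R] (a b : Ideal R)
    (M : ModuleCat R) [Module.Finite R M] :
    cohDim (a + b) M ≤ cohDim a M + cohDim b M := by
  refine csSup_le' fun i hi => ?_
  by_contra! hlt
  obtain ⟨k, rfl⟩ : ∃ k, i = k + 1 := ⟨i - 1, by omega⟩
  refine (LC.V_iff (a + b) k M).1 ?_ hi
  rw [Submodule.add_eq_sup]
  refine LC.F4 a b (Module.annihilator R M) (cohDim a M)
    (LC.F7 a M (cohDim a M) (LC.V_of_cohDim a M)) (cohDim b M) M ?_ (LC.V_of_cohDim b M) _ hlt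
  intro x
  refine ⟨1, fun r hr => ?_⟩
  rw [pow_one] at hr
  exact Module.mem_annihilator.1 hr x
end
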